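/- Let H be a quasi-bialgebra over k and A an H-bimodule algebra. Then the linear maps J: H⊗A → A⊗H, J(h⊗φ) = h₁·φ ⊗ h₂; T: A⊗H → A⊗H, T(φ⊗h) = φ·h₂ ⊗ h₁; γ: A⊗A → A⊗A⊗H, γ(φ⊗φ') = φ·z³ ⊗ z¹·φ' ⊗ z²; and η: A⊗A → A⊗H⊗H, η(φ⊗φ') = (x¹·φ·y²)(x²·φ'·y³) ⊗ x³ ⊗ y¹ (where x, y, z are copies of Φ⁻¹) satisfy the L-R-crossed product axioms (1)-(13) (with U = A, 1_U = 1_A). -/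

import Mathlib

open TensorProduct LinearMap

noncomputable section

variable {k : Type*} [Field k]

section Helpers

variable {M N P Q : Type*}
  [AddCommMonoid M] [AddCommMonoid N] [AddCommMonoid P] [AddCommMonoid Q]
  [Module k M] [Module k N] [Module k P] [Module k Q]

def aso : (M ⊗[k] N) ⊗[k] P →ₗ[k] M ⊗[k] (N ⊗[k] P) :=
  (TensorProduct.assoc k M N P).toLinearMap

def osa : M ⊗[k] (N ⊗[k] P) →ₗ[k] (M ⊗[k] N) ⊗[k] P :=
  (TensorProduct.assoc k M N P).symm.toLinearMap

def cc : M ⊗[k] N →ₗ[k] N ⊗[k] M := (TensorProduct.comm k M N).toLinearMap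

def lc : M ⊗[k] (N ⊗[k] P) →ₗ[k] N ⊗[k] (M ⊗[k] P) :=
  (TensorProduct.leftComm k M N P).toLinearMap

def tt : (M ⊗[k] N) ⊗[k] (P ⊗[k] Q) →ₗ[k] (M ⊗[k] P) ⊗[k] (N ⊗[k] Q) :=
  (TensorProduct.tensorTensorTensorComm k M N P Q).toLinearMap

end Helpers

section LRCrossed

variable (k)
variable (H U : Type*) [Ring H] [Algebra k H] [AddCommGroup U] [Module k U]

abbrev mH : H ⊗[k] H →ₗ[k] H := LinearMap.mul' k H

def dR : (H ⊗[k] H) ⊗[k] H →ₗ[k] H ⊗[k] H :=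
  rTensor H (mH k H) ∘ₗ osa ∘ₗ lTensor H cc ∘ₗ aso

/-- `d ⊗ (g ⊗ i) ↦ (d*g) ⊗ i`. -/
def dL : H ⊗[k] (H ⊗[k] H) →ₗ[k] H ⊗[k] H :=
  rTensor H (mH k H) ∘ₗ osa

/-- `(g ⊗ i) ⊗ d ↦ g ⊗ (d*i)`. -/
def eR : (H ⊗[k] H) ⊗[k] H →ₗ[k] H ⊗[k] H :=
  lTensor H ((mH k H) ∘ₗ cc) ∘ₗ aso

/-- `d ⊗ (g ⊗ i) ↦ g ⊗ (i*d)`. -/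
def eL : H ⊗[k] (H ⊗[k] H) →ₗ[k] H ⊗[k] H :=
  lTensor H ((mH k H) ∘ₗ cc) ∘ₗ lc

/-- `(g ⊗ i) ⊗ (a ⊗ b) ↦ (g*a) ⊗ (b*i)`. -/
def mulLR : (H ⊗[k] H) ⊗[k] (H ⊗[k] H) →ₗ[k] H ⊗[k] H :=
  TensorProduct.map (mH k H) ((mH k H) ∘ₗ cc) ∘ₗ tt


def w12 : H ⊗[k] (H ⊗[k] H) →ₗ[k] H ⊗[k] H :=
  lTensor H ((mH k H) ∘ₗ cc) ∘ₗ lc ∘ₗ lTensor H cc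

def inner12 : (H ⊗[k] H) ⊗[k] (H ⊗[k] H) →ₗ[k] H ⊗[k] H :=
  lTensor H ((mH k H) ∘ₗ cc) ∘ₗ aso ∘ₗ lTensor (H ⊗[k] H) ((mH k H) ∘ₗ cc)

/-- `(g ⊗ i) ⊗ (b ⊗ (d ⊗ e)) ↦ g * d * e * b * i`. -/
def omegaM : (H ⊗[k] H) ⊗[k] (H ⊗[k] (H ⊗[k] H)) →ₗ[k] H :=
  (mH k H) ∘ₗ
    TensorProduct.map (mH k H) ((mH k H) ∘ₗ rTensor H (mH k H) ∘ₗ cc) ∘ₗ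
    tt ∘ₗ lTensor (H ⊗[k] H) (lTensor H cc ∘ₗ lc)

variable {H U}
variable (J : H ⊗[k] U →ₗ[k] U ⊗[k] H) (T : U ⊗[k] H →ₗ[k] U ⊗[k] H)
variable (γ : U ⊗[k] U →ₗ[k] U ⊗[k] (U ⊗[k] H))
variable (η : U ⊗[k] U →ₗ[k] U ⊗[k] (H ⊗[k] H))

variable (oneU : U)

/-- Axiom (1): `J(h ⊗ 1_U) = 1_U ⊗ h` and `J(1_H ⊗ u) = u ⊗ 1_H`. -/
def LRax1 : Prop :=
  (∀ h : H, J (h ⊗ₜ oneU) = oneU ⊗ₜ h) ∧ (∀ u : U, J ((1 : H) ⊗ₜ u) = u ⊗ₜ (1 : H))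

/-- Axiom (2): `T(u ⊗ 1_H) = u ⊗ 1_H` and `T(1_U ⊗ h) = 1_U ⊗ h`. -/
def LRax2 : Prop :=
  (∀ u : U, T (u ⊗ₜ (1 : H)) = u ⊗ₜ (1 : H)) ∧ (∀ h : H, T (oneU ⊗ₜ h) = oneU ⊗ₜ h)

/-- Axiom (3): `γ(u ⊗ 1_U) = u ⊗ 1_U ⊗ 1_H` and `γ(1_U ⊗ u) = 1_U ⊗ u ⊗ 1_H`. -/
def LRax3 : Prop :=
  (∀ u : U, γ (u ⊗ₜ oneU) = u ⊗ₜ (oneU ⊗ₜ (1 : H))) ∧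
  (∀ u : U, γ (oneU ⊗ₜ u) = oneU ⊗ₜ (u ⊗ₜ (1 : H)))

/-- Axiom (4): `η(u ⊗ 1_U) = η(1_U ⊗ u) = u ⊗ 1_H ⊗ 1_H`. -/
def LRax4 : Prop :=
  (∀ u : U, η (u ⊗ₜ oneU) = u ⊗ₜ ((1 : H) ⊗ₜ (1 : H))) ∧
  (∀ u : U, η (oneU ⊗ₜ u) = u ⊗ₜ ((1 : H) ⊗ₜ (1 : H)))

/-- Axiom (5): `u_J ⊗ (hh')_J = (u_J)_j ⊗ h_j h'_J`. -/
def LRax5 : Prop := ∀ (h h' : H) (u : U),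
  J ((h * h') ⊗ₜ u) =
    lTensor U (mH k H) (aso (rTensor H J (osa (h ⊗ₜ (J (h' ⊗ₜ u))))))

/-- Axiom (6): `u_T ⊗ (hh')_T = (u_T)_t ⊗ h_T h'_t`. -/
def LRax6 : Prop := ∀ (u : U) (h h' : H),
  T (u ⊗ₜ (h * h')) =
    lTensor U ((mH k H) ∘ₗ cc)
      (aso (rTensor H T (osa (lTensor U cc (aso ((T (u ⊗ₜ h)) ⊗ₜ h'))))))

/-- Axiom (7):
`η₁(u_J,u'_j) ⊗ η₂(u_J,u'_j)(h_J)_j ⊗ η₃(u_J,u'_j) = η₁(u,u')_J ⊗ h_J η₂(u,u') ⊗ η₃(u,u')`. -/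
def LRax7 : Prop := ∀ (h : H) (u u' : U),
  lTensor U (dR k H)
      (aso (rTensor H η (osa (lTensor U J (aso ((J (h ⊗ₜ u)) ⊗ₜ u'))))))
  = lTensor U (dL k H)
      (aso (rTensor (H ⊗[k] H) J (osa (h ⊗ₜ (η (u ⊗ₜ u'))))))

/-- Axiom (8):
`η₁(u_t,u'_T) ⊗ η₂(u_t,u'_T) ⊗ (h_T)_t η₃(u_t,u'_T) = η₁(u,u')_T ⊗ η₂(u,u') ⊗ η₃(u,u')h_T`. -/
def LRax8 : Prop := ∀ (u u' : U) (h : H),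
  lTensor U (eR k H)
      (aso (rTensor H η (osa (lTensor U cc
        (aso (rTensor U T (osa (lTensor U cc (u ⊗ₜ (T (u' ⊗ₜ h)))))))))))
  = lTensor U (eL k H)
      (aso (rTensor (H ⊗[k] H) T (osa (lTensor U cc (aso ((η (u ⊗ₜ u')) ⊗ₜ h))))))

/-- Axiom (9). -/
def LRax9 : Prop := ∀ (u u' u'' : U),
  lTensor U (mulLR k H)
      (aso (rTensor (H ⊗[k] H) η (osa (lTensor U (aso (P := H))
        ((lTensor U (rTensor H J ∘ₗ osa ∘ₗ lTensor H cc ∘ₗ aso))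
          (aso ((η (u ⊗ₜ u')) ⊗ₜ u'')))))))
  = lTensor U ((mulLR k H) ∘ₗ lTensor (H ⊗[k] H) cc)
      (aso (rTensor (H ⊗[k] H) η (tt (rTensor (U ⊗[k] H) T
        (osa (lTensor U (lc ∘ₗ lTensor U cc) (u ⊗ₜ (η (u' ⊗ₜ u'')))))))))


def qJ : (U ⊗[k] H) ⊗[k] H →ₗ[k] U ⊗[k] H :=
  lTensor U (mH k H) ∘ₗ aso ∘ₗ rTensor H J ∘ₗ osa ∘ₗ lc ∘ₗ lTensor U cc ∘ₗ aso

/-- Axiom (10). -/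
def LRax10 : Prop := ∀ (u u' : U) (h : H),
  lTensor U (lTensor U ((mH k H) ∘ₗ cc))
      (aso (tt (rTensor (U ⊗[k] H) T (osa (lTensor U cc
        (aso (rTensor H γ (osa (u ⊗ₜ (J (h ⊗ₜ u')))))))))))
  = lTensor U (qJ k J)
      (aso (rTensor H γ (osa (lTensor U cc (aso ((T (u ⊗ₜ h)) ⊗ₜ u'))))))

def psi11 : (U ⊗[k] H) ⊗[k] (H ⊗[k] H) →ₗ[k] U ⊗[k] (H ⊗[k] H) :=
  lTensor U (rTensor H (mH k H) ∘ₗ osa) ∘ₗ aso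

def chainX : (U ⊗[k] H) ⊗[k] (U ⊗[k] H) →ₗ[k] U ⊗[k] (H ⊗[k] H) :=
  (lTensor U ((dR k H) ∘ₗ lTensor (H ⊗[k] H) (mH k H))) ∘ₗ aso ∘ₗ
    rTensor (H ⊗[k] H) η ∘ₗ rTensor (H ⊗[k] H) cc ∘ₗ tt ∘ₗ
    lTensor (U ⊗[k] H) cc ∘ₗ rTensor (H ⊗[k] U) J ∘ₗ rTensor (H ⊗[k] U) cc ∘ₗ
    tt ∘ₗ lTensor (U ⊗[k] H) cc

/-- Axiom (11). -/
def LRax11 : Prop := ∀ (u u' u'' : U),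
  lTensor U (psi11 k)
      (aso (tt (rTensor ((U ⊗[k] H) ⊗[k] H) T (tt (rTensor (H ⊗[k] H) γ
        (osa (u ⊗ₜ (η (u' ⊗ₜ u'')))))))))
  = lTensor U (chainX k J η)
      (aso (rTensor (U ⊗[k] H) γ (osa (lTensor U cc
        (aso ((γ (u ⊗ₜ u')) ⊗ₜ u''))))))

def chain12 : (U ⊗[k] H) ⊗[k] (H ⊗[k] H) →ₗ[k] U ⊗[k] (H ⊗[k] H) :=
  (lTensor U (w12 k H)) ∘ₗ aso ∘ₗ tt ∘ₗ rTensor (H ⊗[k] H) J ∘ₗ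
    rTensor (H ⊗[k] H) cc ∘ₗ tt ∘ₗ lTensor (U ⊗[k] H) cc

def big12 : (H ⊗[k] H) ⊗[k] (H ⊗[k] (U ⊗[k] H)) →ₗ[k] U ⊗[k] (H ⊗[k] H) :=
  lTensor U (inner12 k H) ∘ₗ lc ∘ₗ lTensor (H ⊗[k] H) lc

/-- Axiom (12). -/
def LRax12 : Prop := ∀ (u u' u'' : U),
  lTensor U (chain12 k J)
      (aso (rTensor (H ⊗[k] H) γ (osa (lTensor U cc
        (aso ((η (u ⊗ₜ u')) ⊗ₜ u''))))))
  = lTensor U (big12 k)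
      (aso (rTensor (H ⊗[k] (U ⊗[k] H)) η (tt (lTensor (U ⊗[k] H) cc
        (rTensor ((U ⊗[k] H) ⊗[k] U) T (tt (lTensor (U ⊗[k] (U ⊗[k] H)) cc
          (rTensor (U ⊗[k] H) γ (osa (lTensor U lc (u ⊗ₜ (γ (u' ⊗ₜ u'')))))))))))))

def w13 : H ⊗[k] (U ⊗[k] H) →ₗ[k] U ⊗[k] H :=
  lTensor U ((mH k H) ∘ₗ cc) ∘ₗ lc

def xi2 : H ⊗[k] (U ⊗[k] H) →ₗ[k] U ⊗[k] H :=
  lTensor U (mH k H) ∘ₗ aso ∘ₗ rTensor H J ∘ₗ osa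

def xi : H ⊗[k] (U ⊗[k] (U ⊗[k] H)) →ₗ[k] U ⊗[k] (U ⊗[k] H) :=
  lTensor U (xi2 k J) ∘ₗ lc

def rho : (U ⊗[k] H) ⊗[k] U →ₗ[k] (U ⊗[k] (U ⊗[k] H)) ⊗[k] H :=
  rTensor H γ ∘ₗ osa ∘ₗ lTensor U cc ∘ₗ aso

def chainR : ((U ⊗[k] (U ⊗[k] H)) ⊗[k] H) ⊗[k] H →ₗ[k] (U ⊗[k] H) ⊗[k] (U ⊗[k] H) :=
  tt ∘ₗ lTensor (U ⊗[k] U) cc ∘ₗ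
    lTensor (U ⊗[k] U) (rTensor H ((mH k H) ∘ₗ cc) ∘ₗ osa) ∘ₗ tt ∘ₗ
    lTensor (U ⊗[k] H) aso ∘ₗ rTensor ((U ⊗[k] H) ⊗[k] H) T ∘ₗ tt ∘ₗ
    lTensor (U ⊗[k] (U ⊗[k] H)) cc ∘ₗ aso

/-- The composite computing the right-hand side of axiom (13). -/
def rhs13 : ((H ⊗[k] (U ⊗[k] U)) ⊗[k] U) ⊗[k] H →ₗ[k]
    (U ⊗[k] (U ⊗[k] H)) ⊗[k] (U ⊗[k] H) :=
  osa ∘ₗ lTensor U (chainR k T) ∘ₗ aso ∘ₗ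
    rTensor H (lTensor U (rho k γ) ∘ₗ aso ∘ₗ rTensor U ((xi k J) ∘ₗ lTensor H γ))

/-- Axiom (13). -/
def LRax13 : Prop := ∀ (u u' u'' : U) (h h' : H),
  rTensor (U ⊗[k] H) (xi k J)
      (osa (h' ⊗ₜ (lTensor (U ⊗[k] (U ⊗[k] H)) (w13 k)
        (aso (rTensor (U ⊗[k] H) (rTensor H γ) (rTensor (U ⊗[k] H) osa
          (osa (u ⊗ₜ (rTensor (U ⊗[k] H) T (osa (lTensor U cc
            (aso ((γ (u' ⊗ₜ u'')) ⊗ₜ h)))))))))))))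
  = rhs13 k J T γ (((h' ⊗ₜ (u ⊗ₜ u')) ⊗ₜ u'') ⊗ₜ h)

/-- The L-R-crossed product multiplication, as a linear map. -/
def lrM : (U ⊗[k] H) ⊗[k] (U ⊗[k] H) →ₗ[k] U ⊗[k] H :=
  lTensor U (omegaM k H) ∘ₗ aso ∘ₗ rTensor (H ⊗[k] (H ⊗[k] H)) η ∘ₗ tt ∘ₗ
    lTensor (U ⊗[k] H) aso ∘ₗ rTensor ((U ⊗[k] H) ⊗[k] H) T ∘ₗ tt ∘ₗ
    lTensor (U ⊗[k] (U ⊗[k] H)) cc ∘ₗ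
    rTensor (H ⊗[k] H) (lTensor U J ∘ₗ lTensor U cc ∘ₗ aso) ∘ₗ tt ∘ₗ
    rTensor (H ⊗[k] H) (osa ∘ₗ γ) ∘ₗ tt

/-- The L-R-crossed product multiplication of two elements of `U ⊗ H`. -/
def lrMul (x y : U ⊗[k] H) : U ⊗[k] H := lrM k J T γ η (x ⊗ₜ y)

end LRCrossed


section QuasiBialgebra

variable {k : Type*} [Field k]
variable {H : Type*} [Ring H] [Algebra k H]
variable {A : Type*} [AddCommGroup A] [Module k A]

/-- The axioms making `(H, Δ, ε, Φ)` a quasi-bialgebra, where `Φinv` is a two-sided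
inverse of the associator `Φ ∈ H ⊗ H ⊗ H`. -/
structure IsQuasiBialgebra (Δ : H →ₐ[k] H ⊗[k] H) (ε : H →ₐ[k] k)
    (Φ Φinv : (H ⊗[k] H) ⊗[k] H) : Prop where
  coassoc : ∀ h : H,
    osa (lTensor H Δ.toLinearMap (Δ.toLinearMap h)) =
      Φ * (rTensor H Δ.toLinearMap (Δ.toLinearMap h)) * Φinv
  pentagon :
    (osa (lTensor (H ⊗[k] H) Δ.toLinearMap Φ)) *
        (rTensor H (rTensor H Δ.toLinearMap) Φ) =
      (rTensor H (rTensor H (TensorProduct.mk k H H (1 : H))) Φ) *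
        (rTensor H ((osa : H ⊗[k] (H ⊗[k] H) →ₗ[k] (H ⊗[k] H) ⊗[k] H) ∘ₗ
          lTensor H Δ.toLinearMap) Φ) *
        (((TensorProduct.mk k ((H ⊗[k] H) ⊗[k] H) H).flip (1 : H)) Φ)
  counit_left : ∀ h : H, TensorProduct.lid k H (rTensor H ε.toLinearMap (Δ.toLinearMap h)) = h
  counit_right : ∀ h : H, TensorProduct.rid k H (lTensor H ε.toLinearMap (Δ.toLinearMap h)) = h
  counit_phi :
    rTensor H (TensorProduct.rid k H).toLinearMap (rTensor H (lTensor H ε.toLinearMap) Φ) =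
      (1 : H) ⊗ₜ (1 : H)
  phi_inv : Φ * Φinv = 1
  inv_phi : Φinv * Φ = 1

variable (actL : H ⊗[k] A →ₗ[k] A) (actR : A ⊗[k] H →ₗ[k] A)

/-- `X ⊗ (φ ⊗ x) ↦ (X · φ) · x`. -/
def biact : H ⊗[k] (A ⊗[k] H) →ₗ[k] A := actR ∘ₗ rTensor H actL ∘ₗ osa

/-- `(X ⊗ y) ⊗ φ ↦ (X · φ) · y`. -/
def triAct : (H ⊗[k] H) ⊗[k] A →ₗ[k] A :=
  actR ∘ₗ rTensor H actL ∘ₗ osa ∘ₗ lTensor H cc ∘ₗ aso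

/-- Zipping two triples: `((x₁⊗x₂)⊗x₃) ⊗ ((y₁⊗y₂)⊗y₃) ↦ ((x₁⊗y₁)⊗(x₂⊗y₂))⊗(x₃⊗y₃)`. -/
def zip3 {M N : Type*} [AddCommMonoid M] [AddCommMonoid N] [Module k M] [Module k N] :
    ((M ⊗[k] M) ⊗[k] M) ⊗[k] ((N ⊗[k] N) ⊗[k] N) →ₗ[k]
      ((M ⊗[k] N) ⊗[k] (M ⊗[k] N)) ⊗[k] (M ⊗[k] N) :=
  rTensor (M ⊗[k] N) tt ∘ₗ tt

variable (mulA : A ⊗[k] A →ₗ[k] A)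

/-- `Φ ⊗ (Φ⁻¹ ⊗ ((φ⊗φ')⊗φ'')) ↦ (X¹·φ·x¹)((X²·φ'·x²)(X³·φ''·x³))`. -/
def quasiAct : ((H ⊗[k] H) ⊗[k] H) ⊗[k]
    (((H ⊗[k] H) ⊗[k] H) ⊗[k] ((A ⊗[k] A) ⊗[k] A)) →ₗ[k] A :=
  mulA ∘ₗ lTensor A mulA ∘ₗ aso ∘ₗ
    TensorProduct.map (TensorProduct.map (biact actL actR) (biact actL actR))
      (biact actL actR) ∘ₗ
    zip3 ∘ₗ lTensor ((H ⊗[k] H) ⊗[k] H) (zip3 ∘ₗ cc)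

/-- The `H`-bimodule algebra axioms for `A` over the quasi-bialgebra `(H, Δ, ε, Φ)`. -/
structure IsBimoduleAlgebra (Δ : H →ₐ[k] H ⊗[k] H) (ε : H →ₐ[k] k)
    (Φ Φinv : (H ⊗[k] H) ⊗[k] H) (oneA : A) : Prop where
  actL_actL : ∀ (h h' : H) (φ : A), actL (h ⊗ₜ actL (h' ⊗ₜ φ)) = actL ((h * h') ⊗ₜ φ)
  one_actL : ∀ φ : A, actL ((1 : H) ⊗ₜ φ) = φ
  actR_actR : ∀ (φ : A) (h h' : H), actR (actR (φ ⊗ₜ h) ⊗ₜ h') = actR (φ ⊗ₜ (h * h'))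
  actR_one : ∀ φ : A, actR (φ ⊗ₜ (1 : H)) = φ
  actL_actR : ∀ (h : H) (φ : A) (h' : H),
    actR (actL (h ⊗ₜ φ) ⊗ₜ h') = actL (h ⊗ₜ actR (φ ⊗ₜ h'))
  actL_mulA : ∀ (h : H) (φ φ' : A),
    actL (h ⊗ₜ mulA (φ ⊗ₜ φ')) =
      mulA (TensorProduct.map actL actL (tt ((Δ.toLinearMap h) ⊗ₜ (φ ⊗ₜ φ'))))
  actR_mulA : ∀ (h : H) (φ φ' : A),
    actR (mulA (φ ⊗ₜ φ') ⊗ₜ h) =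
      mulA (TensorProduct.map actR actR (tt ((φ ⊗ₜ φ') ⊗ₜ (Δ.toLinearMap h))))
  actL_one : ∀ h : H, actL (h ⊗ₜ oneA) = ε h • oneA
  one_actR : ∀ h : H, actR (oneA ⊗ₜ h) = ε h • oneA
  mulA_one : ∀ φ : A, mulA (φ ⊗ₜ oneA) = φ
  one_mulA : ∀ φ : A, mulA (oneA ⊗ₜ φ) = φ
  quasi_assoc : ∀ φ φ' φ'' : A,
    mulA (mulA (φ ⊗ₜ φ') ⊗ₜ φ'') =
      quasiAct actL actR mulA (Φ ⊗ₜ (Φinv ⊗ₜ ((φ ⊗ₜ φ') ⊗ₜ φ'')))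

variable (Δ : H →ₐ[k] H ⊗[k] H) (Φinv : (H ⊗[k] H) ⊗[k] H)

/-- `J(h ⊗ φ) = h₁·φ ⊗ h₂`. -/
def smashJ : H ⊗[k] A →ₗ[k] A ⊗[k] H :=
  rTensor H actL ∘ₗ osa ∘ₗ lTensor H cc ∘ₗ aso ∘ₗ rTensor A Δ.toLinearMap

/-- `T(φ ⊗ h) = φ·h₂ ⊗ h₁`. -/
def smashT : A ⊗[k] H →ₗ[k] A ⊗[k] H :=
  rTensor H actR ∘ₗ osa ∘ₗ lTensor A cc ∘ₗ lTensor A Δ.toLinearMap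

/-- `((z¹⊗z²)⊗z³) ⊗ (φ⊗φ') ↦ (φ·z³) ⊗ ((z¹·φ') ⊗ z²)`. -/
def smashΓ : ((H ⊗[k] H) ⊗[k] H) ⊗[k] (A ⊗[k] A) →ₗ[k] A ⊗[k] (A ⊗[k] H) :=
  lc ∘ₗ
    lTensor A (cc ∘ₗ lTensor H (actR ∘ₗ cc) ∘ₗ aso) ∘ₗ
    rTensor ((H ⊗[k] H) ⊗[k] A) actL ∘ₗ tt ∘ₗ
    lTensor (H ⊗[k] (H ⊗[k] H)) cc ∘ₗ rTensor (A ⊗[k] A) aso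

/-- `γ(φ ⊗ φ') = φ·z³ ⊗ z¹·φ' ⊗ z²` with `z = Φ⁻¹`. -/
def smashγ : A ⊗[k] A →ₗ[k] A ⊗[k] (A ⊗[k] H) :=
  smashΓ actL actR ∘ₗ TensorProduct.mk k ((H ⊗[k] H) ⊗[k] H) (A ⊗[k] A) Φinv

/-- Reordering and zipping two copies of `Φ⁻¹`:
`((x¹⊗x²)⊗x³) ⊗ ((y¹⊗y²)⊗y³) ↦ ((x¹⊗y²)⊗(x²⊗y³))⊗(x³⊗y¹)`. -/
def smashΞ : ((H ⊗[k] H) ⊗[k] H) ⊗[k] ((H ⊗[k] H) ⊗[k] H) →ₗ[k]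
    ((H ⊗[k] H) ⊗[k] (H ⊗[k] H)) ⊗[k] (H ⊗[k] H) :=
  rTensor (H ⊗[k] H) tt ∘ₗ tt ∘ₗ lTensor ((H ⊗[k] H) ⊗[k] H) (cc ∘ₗ aso)

/-- `((x²⊗y³)⊗(x³⊗y¹)) ⊗ φ' ↦ (x²·φ'·y³) ⊗ (x³⊗y¹)`. -/
def smashSec : (((H ⊗[k] H) ⊗[k] (H ⊗[k] H)) ⊗[k] A) →ₗ[k] A ⊗[k] (H ⊗[k] H) :=
  rTensor (H ⊗[k] H) (triAct actL actR) ∘ₗ osa ∘ₗ lTensor (H ⊗[k] H) cc ∘ₗ aso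

/-- `(Φ⁻¹ ⊗ Φ⁻¹) ⊗ (φ⊗φ') ↦ (x¹·φ·y²)(x²·φ'·y³) ⊗ (x³ ⊗ y¹)`. -/
def smashΛ : (((H ⊗[k] H) ⊗[k] H) ⊗[k] ((H ⊗[k] H) ⊗[k] H)) ⊗[k] (A ⊗[k] A) →ₗ[k]
    A ⊗[k] (H ⊗[k] H) :=
  rTensor (H ⊗[k] H) mulA ∘ₗ osa ∘ₗ
    TensorProduct.map (triAct actL actR) (smashSec actL actR) ∘ₗ tt ∘ₗ
    rTensor (A ⊗[k] A) aso ∘ₗ rTensor (A ⊗[k] A) smashΞ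

/-- `η(φ ⊗ φ') = (x¹·φ·y²)(x²·φ'·y³) ⊗ x³ ⊗ y¹` with `x, y` copies of `Φ⁻¹`. -/
def smashη : A ⊗[k] A →ₗ[k] A ⊗[k] (H ⊗[k] H) :=
  smashΛ actL actR mulA ∘ₗ
    TensorProduct.mk k (((H ⊗[k] H) ⊗[k] H) ⊗[k] ((H ⊗[k] H) ⊗[k] H)) (A ⊗[k] A)
      (Φinv ⊗ₜ Φinv)

end QuasiBialgebra

section Evaluation

variable {M N P Q : Type*}
  [AddCommMonoid M] [AddCommMonoid N] [AddCommMonoid P] [AddCommMonoid Q]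
  [Module k M] [Module k N] [Module k P] [Module k Q]

@[simp] theorem aso_tmul (m : M) (n : N) (p : P) :
    aso ((m ⊗ₜ[k] n) ⊗ₜ[k] p) = m ⊗ₜ (n ⊗ₜ p) := rfl

@[simp] theorem osa_tmul (m : M) (n : N) (p : P) :
    osa (m ⊗ₜ[k] (n ⊗ₜ[k] p)) = (m ⊗ₜ n) ⊗ₜ p := rfl

@[simp] theorem cc_tmul (m : M) (n : N) : cc (m ⊗ₜ[k] n) = n ⊗ₜ m := rfl

@[simp] theorem lc_tmul (m : M) (n : N) (p : P) :
    lc (m ⊗ₜ[k] (n ⊗ₜ[k] p)) = n ⊗ₜ (m ⊗ₜ p) := rfl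

@[simp] theorem tt_tmul (m : M) (n : N) (p : P) (q : Q) :
    tt ((m ⊗ₜ[k] n) ⊗ₜ[k] (p ⊗ₜ[k] q)) = (m ⊗ₜ p) ⊗ₜ (n ⊗ₜ q) := rfl

theorem tmul_induction {p : M ⊗[k] N → Prop} (t : M ⊗[k] N)
    (add : ∀ s t, p s → p t → p (s + t)) (tmul : ∀ m n, p (m ⊗ₜ n)) : p t :=
  TensorProduct.induction_on t (by simpa using tmul 0 0) tmul add

theorem tmul₃_induction {p : (M ⊗[k] N) ⊗[k] P → Prop} (t : (M ⊗[k] N) ⊗[k] P)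
    (add : ∀ s t, p s → p t → p (s + t)) (tmul : ∀ m n q, p ((m ⊗ₜ n) ⊗ₜ q)) : p t := by
  refine tmul_induction t add fun s q => ?_
  refine tmul_induction (p := fun s => p (s ⊗ₜ q)) s (fun s t hs ht => ?_) fun m n => tmul m n q
  simpa only [add_tmul] using add _ _ hs ht

end Evaluation

section EvaluationOps

variable {H A : Type*} [Ring H] [Algebra k H] [AddCommGroup A] [Module k A]

@[simp] theorem dR_tmul (g i d : H) :
    dR k H ((g ⊗ₜ i) ⊗ₜ d) = (g * d) ⊗ₜ i := rfl

@[simp] theorem dL_tmul (d g i : H) :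
    dL k H (d ⊗ₜ (g ⊗ₜ i)) = (d * g) ⊗ₜ i := rfl

@[simp] theorem eR_tmul (g i d : H) :
    eR k H ((g ⊗ₜ i) ⊗ₜ d) = g ⊗ₜ (d * i) := rfl

@[simp] theorem eL_tmul (d g i : H) :
    eL k H (d ⊗ₜ (g ⊗ₜ i)) = g ⊗ₜ (i * d) := rfl

@[simp] theorem mulLR_tmul (g i a b : H) :
    mulLR k H ((g ⊗ₜ i) ⊗ₜ (a ⊗ₜ b)) = (g * a) ⊗ₜ (b * i) := rfl

@[simp] theorem w12_tmul (a b c : H) :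
    w12 k H (a ⊗ₜ (b ⊗ₜ c)) = c ⊗ₜ (b * a) := rfl

@[simp] theorem inner12_tmul (g i b c : H) :
    inner12 k H ((g ⊗ₜ i) ⊗ₜ (b ⊗ₜ c)) = g ⊗ₜ (c * b * i) := rfl

@[simp] theorem psi11_tmul (u : A) (a b c : H) :
    psi11 k ((u ⊗ₜ a) ⊗ₜ (b ⊗ₜ c)) = u ⊗ₜ ((a * b) ⊗ₜ c) := rfl

@[simp] theorem big12_tmul (g i b c : H) (u : A) :
    big12 k ((g ⊗ₜ i) ⊗ₜ (b ⊗ₜ (u ⊗ₜ c))) = u ⊗ₜ (g ⊗ₜ (c * b * i)) := rfl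

@[simp] theorem w13_tmul (a b : H) (u : A) :
    w13 k (a ⊗ₜ (u ⊗ₜ b)) = u ⊗ₜ (b * a) := rfl

variable (actL : H ⊗[k] A →ₗ[k] A) (actR : A ⊗[k] H →ₗ[k] A) (mulA : A ⊗[k] A →ₗ[k] A)

@[simp] theorem triAct_tmul (x y : H) (u : A) :
    triAct actL actR ((x ⊗ₜ y) ⊗ₜ u) = actR (actL (x ⊗ₜ u) ⊗ₜ y) := rfl

@[simp] theorem quasiAct_tmul (a b c x y z : H) (u v w : A) :
    quasiAct actL actR mulA
      (((a ⊗ₜ b) ⊗ₜ c) ⊗ₜ (((x ⊗ₜ y) ⊗ₜ z) ⊗ₜ ((u ⊗ₜ v) ⊗ₜ w))) =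
      mulA (actR (actL (a ⊗ₜ u) ⊗ₜ x) ⊗ₜ
        mulA (actR (actL (b ⊗ₜ v) ⊗ₜ y) ⊗ₜ actR (actL (c ⊗ₜ w) ⊗ₜ z))) := rfl

@[simp] theorem smashΓ_tmul (a b c : H) (u v : A) :
    smashΓ actL actR (((a ⊗ₜ b) ⊗ₜ c) ⊗ₜ (u ⊗ₜ v)) =
      actR (u ⊗ₜ c) ⊗ₜ (actL (a ⊗ₜ v) ⊗ₜ b) := rfl

@[simp] theorem smashΛ_tmul (a b c x y z : H) (u v : A) :
    smashΛ actL actR mulA ((((a ⊗ₜ b) ⊗ₜ c) ⊗ₜ ((x ⊗ₜ y) ⊗ₜ z)) ⊗ₜ (u ⊗ₜ v)) =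
      mulA (actR (actL (a ⊗ₜ u) ⊗ₜ y) ⊗ₜ actR (actL (b ⊗ₜ v) ⊗ₜ z)) ⊗ₜ (c ⊗ₜ x) := rfl

variable (Φinv : (H ⊗[k] H) ⊗[k] H)

theorem smashγ_tmul (u v : A) :
    smashγ actL actR Φinv (u ⊗ₜ v) = smashΓ actL actR (Φinv ⊗ₜ (u ⊗ₜ v)) := rfl

theorem smashη_tmul (u v : A) :
    smashη actL actR mulA Φinv (u ⊗ₜ v) =
      smashΛ actL actR mulA ((Φinv ⊗ₜ Φinv) ⊗ₜ (u ⊗ₜ v)) := rfl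

variable (Δ : H →ₐ[k] H ⊗[k] H)

theorem smashJ_tmul (h : H) (u : A) :
    smashJ actL Δ (h ⊗ₜ u) = rTensor H actL (osa (lTensor H cc (aso (Δ h ⊗ₜ u)))) := rfl

theorem smashT_tmul (u : A) (h : H) :
    smashT actR Δ (u ⊗ₜ h) = rTensor H actR (osa (lTensor A cc (u ⊗ₜ Δ h))) := rfl

end EvaluationOps

section Associator

variable {H : Type*} [Ring H] [Algebra k H]

/-- `Δ ⊗ id`. -/
def comulLeft (Δ : H →ₐ[k] H ⊗[k] H) : H ⊗[k] H →ₐ[k] (H ⊗[k] H) ⊗[k] H :=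
  Algebra.TensorProduct.map Δ (AlgHom.id k H)

/-- `id ⊗ Δ`. -/
def comulRight (Δ : H →ₐ[k] H ⊗[k] H) : H ⊗[k] H →ₐ[k] (H ⊗[k] H) ⊗[k] H :=
  (Algebra.TensorProduct.assoc k k k H H H).symm.toAlgHom.comp
    (Algebra.TensorProduct.map (AlgHom.id k H) Δ)

/-- `Δ ⊗ id ⊗ id`. -/
def comulFst (Δ : H →ₐ[k] H ⊗[k] H) :
    (H ⊗[k] H) ⊗[k] H →ₐ[k] ((H ⊗[k] H) ⊗[k] H) ⊗[k] H :=
  Algebra.TensorProduct.map (comulLeft Δ) (AlgHom.id k H)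

/-- `id ⊗ Δ ⊗ id`. -/
def comulSnd (Δ : H →ₐ[k] H ⊗[k] H) :
    (H ⊗[k] H) ⊗[k] H →ₐ[k] ((H ⊗[k] H) ⊗[k] H) ⊗[k] H :=
  Algebra.TensorProduct.map (comulRight Δ) (AlgHom.id k H)

/-- `id ⊗ id ⊗ Δ`. -/
def comulThd (Δ : H →ₐ[k] H ⊗[k] H) :
    (H ⊗[k] H) ⊗[k] H →ₐ[k] ((H ⊗[k] H) ⊗[k] H) ⊗[k] H :=
  (Algebra.TensorProduct.assoc k k k (H ⊗[k] H) H H).symm.toAlgHom.comp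
    (Algebra.TensorProduct.map (AlgHom.id k (H ⊗[k] H)) Δ)

variable (k H) in
/-- `x ↦ 1 ⊗ x`. -/
def oneTmul : (H ⊗[k] H) ⊗[k] H →ₐ[k] ((H ⊗[k] H) ⊗[k] H) ⊗[k] H :=
  Algebra.TensorProduct.map
    (Algebra.TensorProduct.map Algebra.TensorProduct.includeRight (AlgHom.id k H))
    (AlgHom.id k H)

variable (k H) in
/-- `x ↦ x ⊗ 1`. -/
def tmulOne : (H ⊗[k] H) ⊗[k] H →ₐ[k] ((H ⊗[k] H) ⊗[k] H) ⊗[k] H :=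
  Algebra.TensorProduct.includeLeft

/-- `ε ⊗ id ⊗ id`. -/
def counitFst (ε : H →ₐ[k] k) : (H ⊗[k] H) ⊗[k] H →ₐ[k] H ⊗[k] H :=
  Algebra.TensorProduct.map
    ((Algebra.TensorProduct.lid k H).toAlgHom.comp
      (Algebra.TensorProduct.map ε (AlgHom.id k H))) (AlgHom.id k H)

/-- `id ⊗ ε ⊗ id`. -/
def counitSnd (ε : H →ₐ[k] k) : (H ⊗[k] H) ⊗[k] H →ₐ[k] H ⊗[k] H :=
  Algebra.TensorProduct.map
    ((Algebra.TensorProduct.rid k k H).toAlgHom.comp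
      (Algebra.TensorProduct.map (AlgHom.id k H) ε)) (AlgHom.id k H)

/-- `id ⊗ id ⊗ ε`. -/
def counitThd (ε : H →ₐ[k] k) : (H ⊗[k] H) ⊗[k] H →ₐ[k] H ⊗[k] H :=
  (Algebra.TensorProduct.rid k k (H ⊗[k] H)).toAlgHom.comp
    (Algebra.TensorProduct.map (AlgHom.id k (H ⊗[k] H)) ε)

/-- `id ⊗ ε ⊗ id ⊗ id`. -/
def counitSnd₄ (ε : H →ₐ[k] k) :
    ((H ⊗[k] H) ⊗[k] H) ⊗[k] H →ₐ[k] (H ⊗[k] H) ⊗[k] H :=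
  Algebra.TensorProduct.map (counitSnd ε) (AlgHom.id k H)

/-- `id ⊗ id ⊗ ε ⊗ id`. -/
def counitThd₄ (ε : H →ₐ[k] k) :
    ((H ⊗[k] H) ⊗[k] H) ⊗[k] H →ₐ[k] (H ⊗[k] H) ⊗[k] H :=
  Algebra.TensorProduct.map (counitThd ε) (AlgHom.id k H)

section Pure

variable (Δ : H →ₐ[k] H ⊗[k] H) (ε : H →ₐ[k] k) (a b c d : H)

@[simp] theorem comulLeft_tmul : comulLeft Δ (a ⊗ₜ b) = Δ a ⊗ₜ b := rfl

@[simp] theorem comulRight_tmul : comulRight Δ (a ⊗ₜ b) = osa (a ⊗ₜ Δ b) := rfl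

@[simp] theorem comulFst_tmul :
    comulFst Δ ((a ⊗ₜ b) ⊗ₜ c) = (Δ a ⊗ₜ b) ⊗ₜ c := rfl

@[simp] theorem comulSnd_tmul :
    comulSnd Δ ((a ⊗ₜ b) ⊗ₜ c) = osa (a ⊗ₜ Δ b) ⊗ₜ c := rfl

@[simp] theorem comulThd_tmul :
    comulThd Δ ((a ⊗ₜ b) ⊗ₜ c) = osa ((a ⊗ₜ b) ⊗ₜ Δ c) := rfl

@[simp] theorem oneTmul_tmul :
    oneTmul k H ((a ⊗ₜ b) ⊗ₜ c) = ((1 ⊗ₜ a) ⊗ₜ b) ⊗ₜ c := rfl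

@[simp] theorem tmulOne_apply (x : (H ⊗[k] H) ⊗[k] H) : tmulOne k H x = x ⊗ₜ 1 := rfl

@[simp] theorem counitFst_tmul :
    counitFst ε ((a ⊗ₜ b) ⊗ₜ c) = ε a • (b ⊗ₜ c) := rfl

@[simp] theorem counitSnd_tmul :
    counitSnd ε ((a ⊗ₜ b) ⊗ₜ c) = ε b • (a ⊗ₜ c) := rfl

@[simp] theorem counitThd_tmul :
    counitThd ε ((a ⊗ₜ b) ⊗ₜ c) = ε c • (a ⊗ₜ b) := rfl

@[simp] theorem counitSnd₄_tmul (x : (H ⊗[k] H) ⊗[k] H) :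
    counitSnd₄ ε (x ⊗ₜ d) = counitSnd ε x ⊗ₜ d := rfl

@[simp] theorem counitThd₄_tmul (x : (H ⊗[k] H) ⊗[k] H) :
    counitThd₄ ε (x ⊗ₜ d) = counitThd ε x ⊗ₜ d := rfl

end Pure

theorem mul_eq_mul_mul_of_mul_eq_mul_mul {B : Type*} [Semiring B] {a b c d e a' b' c' d' e' : B}
    (h : a * b = c * d * e) (ha : a' * a = 1) (hb : b' * b = 1) (hc : c * c' = 1)
    (hd : d * d' = 1) (he : e * e' = 1) : b' * a' = e' * d' * c' := by
  refine left_inv_eq_right_inv (a := a * b) ?_ ?_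
  · rw [mul_assoc, ← mul_assoc a', ha, one_mul, hb]
  · rw [h, mul_assoc, mul_assoc, mul_assoc e', ← mul_assoc e, he, one_mul, ← mul_assoc d,
      hd, one_mul, hc]

namespace IsQuasiBialgebra

variable {Δ : H →ₐ[k] H ⊗[k] H} {ε : H →ₐ[k] k} {Φ Φinv : (H ⊗[k] H) ⊗[k] H}

theorem counit_tmul_comul (hqb : IsQuasiBialgebra Δ ε Φ Φinv) (a : H) :
    Algebra.TensorProduct.lid k H (Algebra.TensorProduct.map ε (AlgHom.id k H) (Δ a)) = a :=
  hqb.counit_left a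

theorem comul_tmul_counit (hqb : IsQuasiBialgebra Δ ε Φ Φinv) (a : H) :
    Algebra.TensorProduct.rid k k H (Algebra.TensorProduct.map (AlgHom.id k H) ε (Δ a)) = a :=
  hqb.counit_right a

theorem counitSnd_phi (hqb : IsQuasiBialgebra Δ ε Φ Φinv) : counitSnd ε Φ = 1 := by
  rw [Algebra.TensorProduct.one_def, ← hqb.counit_phi]
  have key (x : (H ⊗[k] H) ⊗[k] H) : counitSnd ε x =
      rTensor H (TensorProduct.rid k H).toLinearMap
        (rTensor H (lTensor H ε.toLinearMap) x) := by
    induction x using tmul₃_induction with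
    | add x y hx hy => simp only [map_add, hx, hy]
    | tmul a b c => rfl
  exact key Φ

theorem pentagon_mul (hqb : IsQuasiBialgebra Δ ε Φ Φinv) :
    comulThd Δ Φ * comulFst Δ Φ = oneTmul k H Φ * comulSnd Δ Φ * tmulOne k H Φ :=
  hqb.pentagon

theorem map_inv_mul {B : Type*} [Semiring B] [Algebra k B] (hqb : IsQuasiBialgebra Δ ε Φ Φinv)
    (f : (H ⊗[k] H) ⊗[k] H →ₐ[k] B) : f Φinv * f Φ = 1 := by
  rw [← map_mul, hqb.inv_phi, map_one]

theorem map_mul_inv {B : Type*} [Semiring B] [Algebra k B] (hqb : IsQuasiBialgebra Δ ε Φ Φinv)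
    (f : (H ⊗[k] H) ⊗[k] H →ₐ[k] B) : f Φ * f Φinv = 1 := by
  rw [← map_mul, hqb.phi_inv, map_one]

theorem map_inv_eq_one {B : Type*} [Semiring B] [Algebra k B] (hqb : IsQuasiBialgebra Δ ε Φ Φinv)
    {f : (H ⊗[k] H) ⊗[k] H →ₐ[k] B} (hf : f Φ = 1) : f Φinv = 1 := by
  simpa [hf] using hqb.map_inv_mul f

theorem pentagon_inv (hqb : IsQuasiBialgebra Δ ε Φ Φinv) :
    comulFst Δ Φinv * comulThd Δ Φinv =
      tmulOne k H Φinv * comulSnd Δ Φinv * oneTmul k H Φinv := by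
  exact mul_eq_mul_mul_of_mul_eq_mul_mul (B := ((H ⊗[k] H) ⊗[k] H) ⊗[k] H) hqb.pentagon_mul
    (hqb.map_inv_mul (comulThd Δ)) (hqb.map_inv_mul (comulFst Δ))
    (hqb.map_mul_inv (oneTmul k H)) (hqb.map_mul_inv (comulSnd Δ)) (hqb.map_mul_inv (tmulOne k H))

theorem comulRight_comul_mul_inv (hqb : IsQuasiBialgebra Δ ε Φ Φinv) (h : H) :
    Φinv * comulRight Δ (Δ h) = comulLeft Δ (Δ h) * Φinv := by
  have := hqb.coassoc h
  change comulRight Δ (Δ h) = Φ * comulLeft Δ (Δ h) * Φinv at this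
  rw [this, ← mul_assoc, ← mul_assoc, hqb.inv_phi, one_mul]

theorem counitSnd₄_comulFst (hqb : IsQuasiBialgebra Δ ε Φ Φinv) (x : (H ⊗[k] H) ⊗[k] H) :
    counitSnd₄ ε (comulFst Δ x) = x := by
  induction x using tmul₃_induction with
  | add x y hx hy => simp only [map_add, hx, hy]
  | tmul a b c =>
    have : (Algebra.TensorProduct.rid k k H) (Algebra.TensorProduct.map (AlgHom.id k H) ε (Δ a))
      ⊗ₜ[k] b ⊗ₜ[k] c = a ⊗ₜ b ⊗ₜ c := by rw [hqb.comul_tmul_counit]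
    exact this

theorem counitSnd₄_comulSnd (hqb : IsQuasiBialgebra Δ ε Φ Φinv) (x : (H ⊗[k] H) ⊗[k] H) :
    counitSnd₄ ε (comulSnd Δ x) = x := by
  induction x using tmul₃_induction with
  | add x y hx hy => simp only [map_add, hx, hy]
  | tmul a b c =>
    have key (t : H ⊗[k] H) : counitSnd ε (osa (a ⊗ₜ t)) =
        a ⊗ₜ Algebra.TensorProduct.lid k H (Algebra.TensorProduct.map ε (AlgHom.id k H) t) := by
      induction t using tmul_induction with
      | add x y hx hy => simp only [map_add, tmul_add, hx, hy]
      | tmul p q => simp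
    simp [key, hqb.counit_tmul_comul]

theorem counitThd₄_comulSnd (hqb : IsQuasiBialgebra Δ ε Φ Φinv) (x : (H ⊗[k] H) ⊗[k] H) :
    counitThd₄ ε (comulSnd Δ x) = x := by
  induction x using tmul₃_induction with
  | add x y hx hy => simp only [map_add, hx, hy]
  | tmul a b c =>
    have key (t : H ⊗[k] H) : counitThd ε (osa (a ⊗ₜ t)) =
        a ⊗ₜ Algebra.TensorProduct.rid k k H (Algebra.TensorProduct.map (AlgHom.id k H) ε t) := by
      induction t using tmul_induction with
      | add x y hx hy => simp only [map_add, tmul_add, hx, hy]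
      | tmul p q => simp
    simp [key, hqb.comul_tmul_counit]

theorem counitThd₄_comulThd (hqb : IsQuasiBialgebra Δ ε Φ Φinv) (x : (H ⊗[k] H) ⊗[k] H) :
    counitThd₄ ε (comulThd Δ x) = x := by
  induction x using tmul₃_induction with
  | add x y hx hy => simp only [map_add, hx, hy]
  | tmul a b c =>
    have key (t : H ⊗[k] H) : counitThd₄ ε (osa ((a ⊗ₜ b) ⊗ₜ t)) =
        (a ⊗ₜ b) ⊗ₜ
          Algebra.TensorProduct.lid k H (Algebra.TensorProduct.map ε (AlgHom.id k H) t) := by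
      induction t using tmul_induction with
      | add x y hx hy => simp only [map_add, tmul_add, hx, hy]
      | tmul p q => simp [smul_tmul]
    simp [key, hqb.counit_tmul_comul]

theorem counitFst_phi (hqb : IsQuasiBialgebra Δ ε Φ Φinv) : counitFst ε Φ = 1 := by
  have h := congrArg (counitSnd₄ ε) hqb.pentagon_mul
  have h₁ (x : (H ⊗[k] H) ⊗[k] H) : counitSnd₄ ε (comulThd Δ x) = comulRight Δ (counitSnd ε x) := by
    induction x using tmul₃_induction with
    | add x y hx hy => simp only [map_add, hx, hy]
    | tmul a b c =>
      simp only [comulThd_tmul, counitSnd_tmul, map_smul, comulRight_tmul]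
      induction Δ c using tmul_induction with
      | add x y hx hy => simp only [map_add, tmul_add, smul_add, hx, hy]
      | tmul p q => simp [smul_tmul']
  have h₂ (x : (H ⊗[k] H) ⊗[k] H) : counitSnd₄ ε (oneTmul k H x) =
      osa ((1 : H) ⊗ₜ[k] counitFst ε x) := by
    induction x using tmul₃_induction with
    | add x y hx hy => simp only [map_add, tmul_add, hx, hy]
    | tmul a b c => simp [smul_tmul']
  rw [map_mul, map_mul, map_mul, hqb.counitSnd₄_comulFst, hqb.counitSnd₄_comulSnd, h₁, h₂,
    tmulOne_apply, counitSnd₄_tmul, hqb.counitSnd_phi, map_one, one_mul,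
    ← Algebra.TensorProduct.one_def, mul_one] at h
  replace h := congrArg (· * Φinv) h
  simp only [mul_assoc, hqb.phi_inv, mul_one] at h
  have h₃ : ∀ t : H ⊗[k] H, counitFst ε (osa ((1 : H) ⊗ₜ[k] t)) = t := fun t => by
    induction t using tmul_induction with
    | add x y hx hy => simp only [map_add, tmul_add, hx, hy]
    | tmul p q => simp
  rw [← h₃ (counitFst ε Φ), ← h, map_one]

theorem counitThd_phi (hqb : IsQuasiBialgebra Δ ε Φ Φinv) : counitThd ε Φ = 1 := by
  have h := congrArg (counitThd₄ ε) hqb.pentagon_mul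
  have h₁ (x : (H ⊗[k] H) ⊗[k] H) : counitThd₄ ε (comulFst Δ x) = comulLeft Δ (counitSnd ε x) := by
    induction x using tmul₃_induction with
    | add x y hx hy => simp only [map_add, hx, hy]
    | tmul a b c =>
      simp only [comulFst_tmul, counitSnd_tmul, map_smul, comulLeft_tmul]
      induction Δ a using tmul_induction with
      | add x y hx hy => simp only [map_add, add_tmul, smul_add, hx, hy]
      | tmul p q => simp [smul_tmul']
  have h₂ (x : (H ⊗[k] H) ⊗[k] H) : counitThd₄ ε (oneTmul k H x) =
      osa ((1 : H) ⊗ₜ[k] counitSnd ε x) := by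
    induction x using tmul₃_induction with
    | add x y hx hy => simp only [map_add, tmul_add, hx, hy]
    | tmul a b c => simp [smul_tmul']
  rw [map_mul, map_mul, map_mul, hqb.counitThd₄_comulThd, hqb.counitThd₄_comulSnd, h₁, h₂,
    tmulOne_apply, counitThd₄_tmul, hqb.counitSnd_phi, map_one, mul_one,
    Algebra.TensorProduct.one_def, osa_tmul, ← Algebra.TensorProduct.one_def,
    ← Algebra.TensorProduct.one_def, one_mul] at h
  replace h := congrArg (Φinv * ·) h
  simp only [← mul_assoc, hqb.inv_phi, one_mul] at h
  have h₃ := congrArg (Algebra.TensorProduct.map (AlgHom.id k (H ⊗[k] H)) ε) h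
  simpa using (congrArg (Algebra.TensorProduct.rid k k (H ⊗[k] H)) h₃).symm

end IsQuasiBialgebra

end Associator

section FourfoldTensor

variable {H : Type*} [Ring H] [Algebra k H]

theorem tmul₄_induction {p : ((H ⊗[k] H) ⊗[k] H) ⊗[k] H → Prop}
    (t : ((H ⊗[k] H) ⊗[k] H) ⊗[k] H)
    (add : ∀ s t, p s → p t → p (s + t))
    (tmul : ∀ a b c d, p (((a ⊗ₜ b) ⊗ₜ c) ⊗ₜ d)) : p t := by
  refine tmul_induction t add fun s q => ?_
  refine tmul₃_induction (p := fun s => p (s ⊗ₜ q)) s (fun s t hs ht => ?_)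
    fun a b c => tmul a b c q
  simpa only [add_tmul] using add _ _ hs ht

variable (x y z : ((H ⊗[k] H) ⊗[k] H) ⊗[k] H)

theorem mul_add₄ : x * (y + z) = x * y + x * z :=
  Semiring.left_distrib x y z

theorem add_mul₄ : (x + y) * z = x * z + y * z :=
  Semiring.right_distrib x y z

theorem mul_assoc₄ : x * y * z = x * (y * z) := mul_assoc x y z

theorem one_mul₄ : 1 * x = x := one_mul x

end FourfoldTensor

section Contractions

variable {H A : Type*} [Ring H] [Algebra k H] [AddCommGroup A] [Module k A]

variable (actL : H ⊗[k] A →ₗ[k] A) (actR : A ⊗[k] H →ₗ[k] A) (mulA : A ⊗[k] A →ₗ[k] A)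

/-- `l ⊗ r ↦ f((l₁·u·r₂) ⊗ (l₂·u'·r₃) ⊗ (l₃·u''·r₄)) ⊗ (l₄ ⊗ r₁)`. -/
def quadAct (f : (A ⊗[k] A) ⊗[k] A →ₗ[k] A) (u u' u'' : A) :
    (((H ⊗[k] H) ⊗[k] H) ⊗[k] H) ⊗[k] (((H ⊗[k] H) ⊗[k] H) ⊗[k] H) →ₗ[k]
      A ⊗[k] (H ⊗[k] H) :=
  let act (v : A) : H ⊗[k] H →ₗ[k] A :=
    triAct actL actR ∘ₗ (TensorProduct.mk k (H ⊗[k] H) A).flip v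
  rTensor (H ⊗[k] H) (f ∘ₗ TensorProduct.map (TensorProduct.map (act u) (act u')) (act u'') ∘ₗ
    zip3) ∘ₗ tt ∘ₗ lTensor (((H ⊗[k] H) ⊗[k] H) ⊗[k] H) (cc ∘ₗ aso ∘ₗ rTensor H aso)

/-- `l ⊗ y ↦ u·l₄ ⊗ (l₁·u'·y₂)(l₂·u''·y₃) ⊗ l₃ ⊗ y₁`. -/
def γηAct (u u' u'' : A) :
    (((H ⊗[k] H) ⊗[k] H) ⊗[k] H) ⊗[k] ((H ⊗[k] H) ⊗[k] H) →ₗ[k]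
      A ⊗[k] (A ⊗[k] (H ⊗[k] H)) :=
  TensorProduct.map (actR ∘ₗ TensorProduct.mk k A H u)
    (smashΛ actL actR mulA ∘ₗ (TensorProduct.mk k _ (A ⊗[k] A)).flip (u' ⊗ₜ u'')) ∘ₗ
    aso ∘ₗ rTensor ((H ⊗[k] H) ⊗[k] H) cc

/-- `x ⊗ r ↦ (x₁·u·r₃)(x₂·u'·r₄) ⊗ r₁·u'' ⊗ x₃ ⊗ r₂`. -/
def ηγAct (u u' u'' : A) :
    ((H ⊗[k] H) ⊗[k] H) ⊗[k] (((H ⊗[k] H) ⊗[k] H) ⊗[k] H) →ₗ[k]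
      A ⊗[k] (A ⊗[k] (H ⊗[k] H)) :=
  lc ∘ₗ TensorProduct.map (actL ∘ₗ (TensorProduct.mk k H A).flip u'')
    (smashΛ actL actR mulA ∘ₗ (TensorProduct.mk k _ (A ⊗[k] A)).flip (u ⊗ₜ u')) ∘ₗ
    lc ∘ₗ lTensor ((H ⊗[k] H) ⊗[k] H) (aso ∘ₗ rTensor H aso)

/-- `l ⊗ r ↦ (u·l₃ ⊗ l₁·u'·r₃ ⊗ l₂) ⊗ (r₁·u'' ⊗ r₂)`. -/
def γγAct (u u' u'' : A) :
    ((H ⊗[k] H) ⊗[k] H) ⊗[k] ((H ⊗[k] H) ⊗[k] H) →ₗ[k]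
      (A ⊗[k] (A ⊗[k] H)) ⊗[k] (A ⊗[k] H) :=
  osa ∘ₗ lTensor A (osa ∘ₗ rTensor (H ⊗[k] (A ⊗[k] H)) actR ∘ₗ tt) ∘ₗ aso ∘ₗ
    TensorProduct.map
      (smashΓ actL actR ∘ₗ (TensorProduct.mk k _ (A ⊗[k] A)).flip (u ⊗ₜ u'))
      (cc ∘ₗ rTensor H (rTensor H (actL ∘ₗ (TensorProduct.mk k H A).flip u'')))

variable (u u' u'' : A) (a b c d p q r s : H)

@[simp] theorem quadAct_tmul (f : (A ⊗[k] A) ⊗[k] A →ₗ[k] A) :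
    quadAct actL actR f u u' u''
      ((((a ⊗ₜ b) ⊗ₜ c) ⊗ₜ d) ⊗ₜ (((p ⊗ₜ q) ⊗ₜ r) ⊗ₜ s)) =
      f ((actR (actL (a ⊗ₜ u) ⊗ₜ q) ⊗ₜ actR (actL (b ⊗ₜ u') ⊗ₜ r)) ⊗ₜ
        actR (actL (c ⊗ₜ u'') ⊗ₜ s)) ⊗ₜ (d ⊗ₜ p) := rfl

@[simp] theorem γηAct_tmul :
    γηAct actL actR mulA u u' u''
      ((((a ⊗ₜ b) ⊗ₜ c) ⊗ₜ d) ⊗ₜ ((p ⊗ₜ q) ⊗ₜ r)) =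
      actR (u ⊗ₜ d) ⊗ₜ (mulA (actR (actL (a ⊗ₜ u') ⊗ₜ q) ⊗ₜ
        actR (actL (b ⊗ₜ u'') ⊗ₜ r)) ⊗ₜ (c ⊗ₜ p)) := rfl

@[simp] theorem ηγAct_tmul :
    ηγAct actL actR mulA u u' u''
      (((a ⊗ₜ b) ⊗ₜ c) ⊗ₜ (((p ⊗ₜ q) ⊗ₜ r) ⊗ₜ s)) =
      mulA (actR (actL (a ⊗ₜ u) ⊗ₜ r) ⊗ₜ actR (actL (b ⊗ₜ u') ⊗ₜ s)) ⊗ₜ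
        (actL (p ⊗ₜ u'') ⊗ₜ (c ⊗ₜ q)) := rfl

@[simp] theorem γγAct_tmul :
    γγAct actL actR u u' u'' (((a ⊗ₜ b) ⊗ₜ c) ⊗ₜ ((p ⊗ₜ q) ⊗ₜ r)) =
      (actR (u ⊗ₜ c) ⊗ₜ (actR (actL (a ⊗ₜ u') ⊗ₜ r) ⊗ₜ b)) ⊗ₜ
        (actL (p ⊗ₜ u'') ⊗ₜ q) := rfl

end Contractions

section Composites

variable {H A : Type*} [Ring H] [Algebra k H] [AddCommGroup A] [Module k A]

theorem chainX_tmul (J : H ⊗[k] A →ₗ[k] A ⊗[k] H) (η : A ⊗[k] A →ₗ[k] A ⊗[k] (H ⊗[k] H))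
    (u v : A) (a b : H) :
    chainX k J η ((u ⊗ₜ a) ⊗ₜ (v ⊗ₜ b)) =
      lTensor A (dR k H ∘ₗ lTensor (H ⊗[k] H) (mH k H)) (aso (rTensor (H ⊗[k] H) η
        (rTensor (H ⊗[k] H) cc (tt (lTensor (A ⊗[k] H) cc (J (b ⊗ₜ u) ⊗ₜ (a ⊗ₜ v))))))) := rfl

theorem chain12_tmul (J : H ⊗[k] A →ₗ[k] A ⊗[k] H) (v : A) (a b c : H) :
    chain12 k J ((v ⊗ₜ a) ⊗ₜ (b ⊗ₜ c)) =
      lTensor A (w12 k H) (aso (tt (J (c ⊗ₜ v) ⊗ₜ (a ⊗ₜ b)))) := rfl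

theorem xi_tmul (J : H ⊗[k] A →ₗ[k] A ⊗[k] H) (h a : H) (u v : A) :
    xi k J (h ⊗ₜ (u ⊗ₜ (v ⊗ₜ a))) =
      u ⊗ₜ lTensor A (mH k H) (aso (J (h ⊗ₜ v) ⊗ₜ a)) := rfl

theorem rho_tmul (γ : A ⊗[k] A →ₗ[k] A ⊗[k] (A ⊗[k] H)) (u v : A) (a : H) :
    rho k γ ((u ⊗ₜ a) ⊗ₜ v) = γ (u ⊗ₜ v) ⊗ₜ a := rfl

theorem chainR_tmul (T : A ⊗[k] H →ₗ[k] A ⊗[k] H) (u v : A) (a b h : H) :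
    chainR k T (((u ⊗ₜ (v ⊗ₜ a)) ⊗ₜ b) ⊗ₜ h) =
      tt (lTensor (A ⊗[k] A) cc (lTensor (A ⊗[k] A) (rTensor H (mH k H ∘ₗ cc) ∘ₗ osa)
        (tt (lTensor (A ⊗[k] H) aso (T (u ⊗ₜ h) ⊗ₜ ((v ⊗ₜ a) ⊗ₜ b)))))) := rfl

end Composites

section Axioms

variable {H A : Type*} [Ring H] [Algebra k H] [AddCommGroup A] [Module k A]
  {Δ : H →ₐ[k] H ⊗[k] H} {ε : H →ₐ[k] k} {Φ Φinv : (H ⊗[k] H) ⊗[k] H}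
  {actL : H ⊗[k] A →ₗ[k] A} {actR : A ⊗[k] H →ₗ[k] A} {mulA : A ⊗[k] A →ₗ[k] A} {oneA : A}

namespace IsBimoduleAlgebra

theorem lrax1 (hqb : IsQuasiBialgebra Δ ε Φ Φinv)
    (hba : IsBimoduleAlgebra actL actR mulA Δ ε Φ Φinv oneA) :
    LRax1 k (smashJ actL Δ) oneA := by
  refine ⟨fun h => ?_, fun u => ?_⟩
  · have key (t : H ⊗[k] H) : rTensor H actL (osa (lTensor H cc (aso (t ⊗ₜ oneA)))) =
        oneA ⊗ₜ TensorProduct.lid k H (rTensor H ε.toLinearMap t) := by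
      induction t using tmul_induction with
      | add x y hx hy => simp only [map_add, add_tmul, tmul_add, hx, hy]
      | tmul a b => simp [hba.actL_one, smul_tmul]
    rw [smashJ_tmul, key]
    exact congrArg _ (hqb.counit_left h)
  · simp [smashJ_tmul, Algebra.TensorProduct.one_def, hba.one_actL]

theorem lrax2 (hqb : IsQuasiBialgebra Δ ε Φ Φinv)
    (hba : IsBimoduleAlgebra actL actR mulA Δ ε Φ Φinv oneA) :
    LRax2 k (smashT actR Δ) oneA := by
  refine ⟨fun u => ?_, fun h => ?_⟩
  · simp [smashT_tmul, Algebra.TensorProduct.one_def, hba.actR_one]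
  · have key (t : H ⊗[k] H) : rTensor H actR (osa (lTensor A cc (oneA ⊗ₜ t))) =
        oneA ⊗ₜ TensorProduct.rid k H (lTensor H ε.toLinearMap t) := by
      induction t using tmul_induction with
      | add x y hx hy => simp only [map_add, tmul_add, hx, hy]
      | tmul a b => simp [hba.one_actR, smul_tmul]
    rw [smashT_tmul, key]
    exact congrArg _ (hqb.counit_right h)

theorem lrax3 (hqb : IsQuasiBialgebra Δ ε Φ Φinv)
    (hba : IsBimoduleAlgebra actL actR mulA Δ ε Φ Φinv oneA) :
    LRax3 k (smashγ actL actR Φinv) oneA := by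
  refine ⟨fun u => ?_, fun u => ?_⟩
  · have key (z : (H ⊗[k] H) ⊗[k] H) : smashΓ actL actR (z ⊗ₜ (u ⊗ₜ oneA)) =
        lTensor A (TensorProduct.mk k A H oneA)
          (rTensor H (actR ∘ₗ TensorProduct.mk k A H u) (cc (counitFst ε z))) := by
      induction z using tmul₃_induction with
      | add x y hx hy => simp only [map_add, add_tmul, hx, hy]
      | tmul a b c => simp [hba.actL_one, smul_tmul]
    rw [smashγ_tmul, key, hqb.map_inv_eq_one hqb.counitFst_phi]
    simp [Algebra.TensorProduct.one_def, hba.actR_one]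
  · have key (z : (H ⊗[k] H) ⊗[k] H) : smashΓ actL actR (z ⊗ₜ (oneA ⊗ₜ u)) =
        oneA ⊗ₜ rTensor H (actL ∘ₗ (TensorProduct.mk k H A).flip u) (counitThd ε z) := by
      induction z using tmul₃_induction with
      | add x y hx hy => simp only [map_add, add_tmul, tmul_add, hx, hy]
      | tmul a b c => simp [hba.one_actR, smul_tmul]
    rw [smashγ_tmul, key, hqb.map_inv_eq_one hqb.counitThd_phi]
    simp [Algebra.TensorProduct.one_def, hba.one_actL]

theorem lrax4 (hqb : IsQuasiBialgebra Δ ε Φ Φinv)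
    (hba : IsBimoduleAlgebra actL actR mulA Δ ε Φ Φinv oneA) :
    LRax4 k (smashη actL actR mulA Φinv) oneA := by
  have e₁ := hqb.map_inv_eq_one hqb.counitFst_phi
  have e₂ := hqb.map_inv_eq_one hqb.counitSnd_phi
  have e₃ := hqb.map_inv_eq_one hqb.counitThd_phi
  refine ⟨fun u => ?_, fun u => ?_⟩
  · have key (x y : (H ⊗[k] H) ⊗[k] H) :
        smashΛ actL actR mulA ((x ⊗ₜ y) ⊗ₜ (u ⊗ₜ oneA)) =
          rTensor (H ⊗[k] H) (triAct actL actR ∘ₗ (TensorProduct.mk k (H ⊗[k] H) A).flip u)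
            (tt (counitSnd ε x ⊗ₜ cc (counitThd ε y))) := by
      induction x using tmul₃_induction with
      | add x y hx hy => simp only [map_add, add_tmul, hx, hy]
      | tmul a b c =>
        induction y using tmul₃_induction with
        | add x y hx hy => simp only [map_add, add_tmul, tmul_add, hx, hy]
        | tmul p q r =>
          simp [hba.actL_one, hba.one_actR, hba.mulA_one, ← smul_tmul', smul_smul, mul_comm]
    rw [smashη_tmul, key, e₂, e₃]
    simp [Algebra.TensorProduct.one_def, hba.one_actL, hba.actR_one]
  · have key (x y : (H ⊗[k] H) ⊗[k] H) :
        smashΛ actL actR mulA ((x ⊗ₜ y) ⊗ₜ (oneA ⊗ₜ u)) =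
          rTensor (H ⊗[k] H) (triAct actL actR ∘ₗ (TensorProduct.mk k (H ⊗[k] H) A).flip u)
            (tt (counitFst ε x ⊗ₜ cc (counitSnd ε y))) := by
      induction x using tmul₃_induction with
      | add x y hx hy => simp only [map_add, add_tmul, hx, hy]
      | tmul a b c =>
        induction y using tmul₃_induction with
        | add x y hx hy => simp only [map_add, add_tmul, tmul_add, hx, hy]
        | tmul p q r =>
          simp [hba.actL_one, hba.one_actR, hba.one_mulA, ← smul_tmul', smul_smul, mul_comm]
    rw [smashη_tmul, key, e₁, e₂]
    simp [Algebra.TensorProduct.one_def, hba.one_actL, hba.actR_one]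

theorem lrax5 (hba : IsBimoduleAlgebra actL actR mulA Δ ε Φ Φinv oneA) :
    LRax5 k (smashJ actL Δ) := by
  intro h h' u
  simp only [smashJ_tmul, map_mul]
  induction Δ h' using tmul_induction with
  | add x y hx hy => simp only [map_add, add_tmul, tmul_add, mul_add, hx, hy]
  | tmul a b =>
    simp only [aso_tmul, osa_tmul, cc_tmul, lTensor_tmul, rTensor_tmul, smashJ_tmul]
    induction Δ h using tmul_induction with
    | add x y hx hy => simp only [map_add, add_tmul, add_mul, hx, hy]
    | tmul c d => simp [hba.actL_actL]

theorem lrax6 (hba : IsBimoduleAlgebra actL actR mulA Δ ε Φ Φinv oneA) :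
    LRax6 k (smashT actR Δ) := by
  intro u h h'
  simp only [smashT_tmul, map_mul]
  induction Δ h using tmul_induction with
  | add x y hx hy => simp only [map_add, add_tmul, tmul_add, add_mul, hx, hy]
  | tmul a b =>
    simp only [aso_tmul, osa_tmul, cc_tmul, lTensor_tmul, rTensor_tmul, smashT_tmul]
    induction Δ h' using tmul_induction with
    | add x y hx hy => simp only [map_add, add_tmul, tmul_add, mul_add, hx, hy]
    | tmul c d => simp [hba.actR_actR]

theorem lrax7_left (hba : IsBimoduleAlgebra actL actR mulA Δ ε Φ Φinv oneA)
    (h : H) (u u' : A) :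
    lTensor A (dR k H) (aso (rTensor H (smashη actL actR mulA Φinv)
      (osa (lTensor A (smashJ actL Δ) (aso (smashJ actL Δ (h ⊗ₜ u) ⊗ₜ u')))))) =
    smashΛ actL actR mulA (((Φinv * comulRight Δ (Δ h)) ⊗ₜ Φinv) ⊗ₜ (u ⊗ₜ u')) := by
  rw [smashJ_tmul]
  induction Δ h using tmul_induction with
  | add x y hx hy => simp only [map_add, add_tmul, mul_add, hx, hy]
  | tmul a b =>
    simp only [aso_tmul, osa_tmul, cc_tmul, lTensor_tmul, rTensor_tmul, smashJ_tmul,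
      comulRight_tmul]
    induction Δ b using tmul_induction with
    | add x y hx hy => simp only [map_add, add_tmul, tmul_add, mul_add, hx, hy]
    | tmul c d =>
      simp only [aso_tmul, osa_tmul, cc_tmul, lTensor_tmul, rTensor_tmul, smashη_tmul]
      suffices ∀ x y : (H ⊗[k] H) ⊗[k] H,
          lTensor A (dR k H) (aso (smashΛ actL actR mulA
            ((x ⊗ₜ y) ⊗ₜ (actL (a ⊗ₜ u) ⊗ₜ actL (c ⊗ₜ u'))) ⊗ₜ d)) =
          smashΛ actL actR mulA (((x * osa (a ⊗ₜ (c ⊗ₜ d))) ⊗ₜ y) ⊗ₜ (u ⊗ₜ u')) from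
        this Φinv Φinv
      intro x y
      induction x using tmul₃_induction with
      | add x y hx hy => simp only [map_add, add_tmul, add_mul, hx, hy]
      | tmul x₁ x₂ x₃ =>
        induction y using tmul₃_induction with
        | add x y hx hy => simp only [map_add, add_tmul, tmul_add, hx, hy]
        | tmul y₁ y₂ y₃ => simp [hba.actL_actL]

theorem lrax7_right (hba : IsBimoduleAlgebra actL actR mulA Δ ε Φ Φinv oneA)
    (h : H) (u u' : A) :
    lTensor A (dL k H) (aso (rTensor (H ⊗[k] H) (smashJ actL Δ)
      (osa (h ⊗ₜ smashη actL actR mulA Φinv (u ⊗ₜ u'))))) =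
    smashΛ actL actR mulA (((comulLeft Δ (Δ h) * Φinv) ⊗ₜ Φinv) ⊗ₜ (u ⊗ₜ u')) := by
  rw [smashη_tmul]
  suffices ∀ x y : (H ⊗[k] H) ⊗[k] H,
      lTensor A (dL k H) (aso (rTensor (H ⊗[k] H) (smashJ actL Δ)
        (osa (h ⊗ₜ smashΛ actL actR mulA ((x ⊗ₜ y) ⊗ₜ (u ⊗ₜ u')))))) =
      smashΛ actL actR mulA (((comulLeft Δ (Δ h) * x) ⊗ₜ y) ⊗ₜ (u ⊗ₜ u')) from
    this Φinv Φinv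
  intro x y
  induction x using tmul₃_induction with
  | add x y hx hy => simp only [map_add, add_tmul, tmul_add, mul_add, hx, hy]
  | tmul x₁ x₂ x₃ =>
    induction y using tmul₃_induction with
    | add x y hx hy => simp only [map_add, add_tmul, tmul_add, hx, hy]
    | tmul y₁ y₂ y₃ =>
      simp only [smashΛ_tmul, osa_tmul, rTensor_tmul, smashJ_tmul]
      induction Δ h using tmul_induction with
      | add x y hx hy => simp only [map_add, add_tmul, add_mul, hx, hy]
      | tmul a b =>
        simp only [aso_tmul, osa_tmul, cc_tmul, lTensor_tmul, rTensor_tmul, hba.actL_mulA,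
          AlgHom.toLinearMap_apply, comulLeft_tmul, dL_tmul]
        induction Δ a using tmul_induction with
        | add x y hx hy => simp only [map_add, add_tmul, add_mul, hx, hy]
        | tmul c d => simp [← hba.actL_actR, hba.actL_actL]

theorem lrax7 (hqb : IsQuasiBialgebra Δ ε Φ Φinv)
    (hba : IsBimoduleAlgebra actL actR mulA Δ ε Φ Φinv oneA) :
    LRax7 k (smashJ actL Δ) (smashη actL actR mulA Φinv) := by
  intro h u u'
  rw [hba.lrax7_left, hba.lrax7_right, hqb.comulRight_comul_mul_inv]

theorem lrax8_left (hba : IsBimoduleAlgebra actL actR mulA Δ ε Φ Φinv oneA)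
    (u u' : A) (h : H) :
    lTensor A (eR k H) (aso (rTensor H (smashη actL actR mulA Φinv) (osa (lTensor A cc
      (aso (rTensor A (smashT actR Δ)
        (osa (lTensor A cc (u ⊗ₜ smashT actR Δ (u' ⊗ₜ h)))))))))) =
    smashΛ actL actR mulA ((Φinv ⊗ₜ (comulLeft Δ (Δ h) * Φinv)) ⊗ₜ (u ⊗ₜ u')) := by
  rw [smashT_tmul]
  induction Δ h using tmul_induction with
  | add x y hx hy => simp only [map_add, add_tmul, tmul_add, add_mul, hx, hy]
  | tmul a b =>
    simp only [osa_tmul, cc_tmul, lTensor_tmul, rTensor_tmul, smashT_tmul, comulLeft_tmul]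
    induction Δ a using tmul_induction with
    | add x y hx hy => simp only [map_add, add_tmul, tmul_add, add_mul, hx, hy]
    | tmul c d =>
      simp only [aso_tmul, osa_tmul, cc_tmul, lTensor_tmul, rTensor_tmul, smashη_tmul]
      suffices ∀ x y : (H ⊗[k] H) ⊗[k] H,
          lTensor A (eR k H) (aso (smashΛ actL actR mulA
            ((x ⊗ₜ y) ⊗ₜ (actR (u ⊗ₜ d) ⊗ₜ actR (u' ⊗ₜ b))) ⊗ₜ c)) =
          smashΛ actL actR mulA ((x ⊗ₜ (((c ⊗ₜ d) ⊗ₜ b) * y)) ⊗ₜ (u ⊗ₜ u')) from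
        this Φinv Φinv
      intro x y
      induction x using tmul₃_induction with
      | add x y hx hy => simp only [map_add, add_tmul, hx, hy]
      | tmul x₁ x₂ x₃ =>
        induction y using tmul₃_induction with
        | add x y hx hy => simp only [map_add, add_tmul, tmul_add, mul_add, hx, hy]
        | tmul y₁ y₂ y₃ => simp [hba.actL_actR, hba.actR_actR]

theorem lrax8_right (hba : IsBimoduleAlgebra actL actR mulA Δ ε Φ Φinv oneA)
    (u u' : A) (h : H) :
    lTensor A (eL k H) (aso (rTensor (H ⊗[k] H) (smashT actR Δ)
      (osa (lTensor A cc (aso (smashη actL actR mulA Φinv (u ⊗ₜ u') ⊗ₜ h)))))) =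
    smashΛ actL actR mulA ((Φinv ⊗ₜ (Φinv * comulRight Δ (Δ h))) ⊗ₜ (u ⊗ₜ u')) := by
  rw [smashη_tmul]
  suffices ∀ x y : (H ⊗[k] H) ⊗[k] H,
      lTensor A (eL k H) (aso (rTensor (H ⊗[k] H) (smashT actR Δ)
        (osa (lTensor A cc (aso (smashΛ actL actR mulA ((x ⊗ₜ y) ⊗ₜ (u ⊗ₜ u')) ⊗ₜ h)))))) =
      smashΛ actL actR mulA ((x ⊗ₜ (y * comulRight Δ (Δ h))) ⊗ₜ (u ⊗ₜ u')) from
    this Φinv Φinv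
  intro x y
  induction x using tmul₃_induction with
  | add x y hx hy => simp only [map_add, add_tmul, hx, hy]
  | tmul x₁ x₂ x₃ =>
    induction y using tmul₃_induction with
    | add x y hx hy => simp only [map_add, add_tmul, tmul_add, add_mul, hx, hy]
    | tmul y₁ y₂ y₃ =>
      simp only [smashΛ_tmul, aso_tmul, osa_tmul, cc_tmul, lTensor_tmul, rTensor_tmul,
        smashT_tmul]
      induction Δ h using tmul_induction with
      | add x y hx hy => simp only [map_add, add_tmul, tmul_add, mul_add, hx, hy]
      | tmul a b =>
        simp only [aso_tmul, osa_tmul, cc_tmul, lTensor_tmul, rTensor_tmul, hba.actR_mulA,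
          AlgHom.toLinearMap_apply, comulRight_tmul, eL_tmul]
        induction Δ b using tmul_induction with
        | add x y hx hy => simp only [map_add, add_tmul, tmul_add, mul_add, hx, hy]
        | tmul c d => simp [hba.actR_actR]

theorem lrax8 (hqb : IsQuasiBialgebra Δ ε Φ Φinv)
    (hba : IsBimoduleAlgebra actL actR mulA Δ ε Φ Φinv oneA) :
    LRax8 k (smashT actR Δ) (smashη actL actR mulA Φinv) := by
  intro u u' h
  rw [hba.lrax8_left, hba.lrax8_right, hqb.comulRight_comul_mul_inv]

theorem quadAct_assoc (hba : IsBimoduleAlgebra actL actR mulA Δ ε Φ Φinv oneA)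
    (u u' u'' : A) (l r : ((H ⊗[k] H) ⊗[k] H) ⊗[k] H) :
    quadAct actL actR (mulA ∘ₗ rTensor A mulA) u u' u'' (l ⊗ₜ r) =
      quadAct actL actR (mulA ∘ₗ lTensor A mulA ∘ₗ aso) u u' u''
        ((tmulOne k H Φ * l) ⊗ₜ (r * oneTmul k H Φinv)) := by
  induction l using tmul₄_induction with
  | add x y hx hy => simp only [map_add, add_tmul, mul_add₄, hx, hy]
  | tmul l₁ l₂ l₃ l₄ =>
    induction r using tmul₄_induction with
    | add x y hx hy => simp only [map_add, tmul_add, add_mul₄, hx, hy]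
    | tmul r₁ r₂ r₃ r₄ =>
      simp only [quadAct_tmul, comp_apply, rTensor_tmul, hba.quasi_assoc, tmulOne_apply]
      suffices ∀ x y : (H ⊗[k] H) ⊗[k] H,
          quasiAct actL actR mulA (x ⊗ₜ (y ⊗ₜ
            ((actR (actL (l₁ ⊗ₜ u) ⊗ₜ r₂) ⊗ₜ actR (actL (l₂ ⊗ₜ u') ⊗ₜ r₃)) ⊗ₜ
              actR (actL (l₃ ⊗ₜ u'') ⊗ₜ r₄)))) ⊗ₜ (l₄ ⊗ₜ r₁) =
          quadAct actL actR (mulA ∘ₗ lTensor A mulA ∘ₗ aso) u u' u''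
            ((x ⊗ₜ 1 * (((l₁ ⊗ₜ l₂) ⊗ₜ l₃) ⊗ₜ l₄)) ⊗ₜ
              ((((r₁ ⊗ₜ r₂) ⊗ₜ r₃) ⊗ₜ r₄) * oneTmul k H y)) from this Φ Φinv
      intro x y
      induction x using tmul₃_induction with
      | add x y hx hy => simp only [map_add, add_tmul, add_mul₄, hx, hy]
      | tmul x₁ x₂ x₃ =>
        induction y using tmul₃_induction with
        | add x y hx hy => simp only [map_add, add_tmul, tmul_add, mul_add₄, hx, hy]
        | tmul y₁ y₂ y₃ => simp [← hba.actL_actR, hba.actL_actL, hba.actR_actR]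

theorem lrax9_left (hba : IsBimoduleAlgebra actL actR mulA Δ ε Φ Φinv oneA) (u u' u'' : A) :
    lTensor A (mulLR k H) (aso (rTensor (H ⊗[k] H) (smashη actL actR mulA Φinv)
      (osa (lTensor A (aso (P := H))
        (lTensor A (rTensor H (smashJ actL Δ) ∘ₗ osa ∘ₗ lTensor H cc ∘ₗ aso)
          (aso (smashη actL actR mulA Φinv (u ⊗ₜ u') ⊗ₜ u''))))))) =
    quadAct actL actR (mulA ∘ₗ rTensor A mulA) u u' u''
      ((comulFst Δ Φinv * comulThd Δ Φinv) ⊗ₜ (tmulOne k H Φinv * comulSnd Δ Φinv)) := by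
  suffices ∀ x y z w : (H ⊗[k] H) ⊗[k] H,
      lTensor A (mulLR k H) (aso (rTensor (H ⊗[k] H)
        (smashΛ actL actR mulA ∘ₗ TensorProduct.mk k _ (A ⊗[k] A) (z ⊗ₜ w))
        (osa (lTensor A (aso (P := H))
          (lTensor A (rTensor H (smashJ actL Δ) ∘ₗ osa ∘ₗ lTensor H cc ∘ₗ aso)
            (aso (smashΛ actL actR mulA ((x ⊗ₜ y) ⊗ₜ (u ⊗ₜ u')) ⊗ₜ u''))))))) =
      quadAct actL actR (mulA ∘ₗ rTensor A mulA) u u' u''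
        ((comulFst Δ z * comulThd Δ x) ⊗ₜ (tmulOne k H y * comulSnd Δ w)) from
    this Φinv Φinv Φinv Φinv
  intro x y z w
  induction x using tmul₃_induction with
  | add x y hx hy => simp only [map_add, add_tmul, mul_add₄, hx, hy]
  | tmul x₁ x₂ x₃ =>
  induction y using tmul₃_induction with
  | add x y hx hy => simp only [map_add, add_tmul, tmul_add, add_mul₄, hx, hy]
  | tmul y₁ y₂ y₃ =>
  simp only [smashΛ_tmul, aso_tmul, osa_tmul, cc_tmul, lTensor_tmul, rTensor_tmul, comp_apply,
    smashJ_tmul, comulThd_tmul, tmulOne_apply]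
  induction Δ x₃ using tmul_induction with
  | add x y hx hy => simp only [map_add, add_tmul, tmul_add, mul_add₄, hx, hy]
  | tmul a b =>
  induction z using tmul₃_induction with
  | add x y hx hy =>
    simp only [map_add, add_tmul, add_mul₄, comp_add, rTensor_add, LinearMap.add_apply, hx, hy]
  | tmul z₁ z₂ z₃ =>
  induction w using tmul₃_induction with
  | add x y hx hy =>
    simp only [map_add, tmul_add, mul_add₄, comp_add, rTensor_add, LinearMap.add_apply, hx, hy]
  | tmul w₁ w₂ w₃ =>
  simp only [smashΛ_tmul, aso_tmul, osa_tmul, cc_tmul, lTensor_tmul, rTensor_tmul, comp_apply,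
    mk_apply, mulLR_tmul, comulFst_tmul, comulSnd_tmul, hba.actL_mulA,
    AlgHom.toLinearMap_apply]
  induction Δ z₁ using tmul_induction with
  | add x y hx hy =>
    simp only [map_add, add_tmul, add_mul₄, hx, hy]
  | tmul c d =>
  simp only [tt_tmul, map_tmul, hba.actR_mulA, AlgHom.toLinearMap_apply]
  induction Δ w₂ using tmul_induction with
  | add x y hx hy => simp only [map_add, add_tmul, tmul_add, mul_add₄, hx, hy]
  | tmul p q => simp [← hba.actL_actR, hba.actL_actL, hba.actR_actR]

theorem lrax9_right (hba : IsBimoduleAlgebra actL actR mulA Δ ε Φ Φinv oneA) (u u' u'' : A) :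
    lTensor A (mulLR k H ∘ₗ lTensor (H ⊗[k] H) cc)
      (aso (rTensor (H ⊗[k] H) (smashη actL actR mulA Φinv) (tt (rTensor (A ⊗[k] H)
        (smashT actR Δ) (osa (lTensor A (lc ∘ₗ lTensor A cc)
          (u ⊗ₜ smashη actL actR mulA Φinv (u' ⊗ₜ u'')))))))) =
    quadAct actL actR (mulA ∘ₗ lTensor A mulA ∘ₗ aso) u u' u''
      ((comulSnd Δ Φinv * oneTmul k H Φinv) ⊗ₜ (comulFst Δ Φinv * comulThd Δ Φinv)) := by
  suffices ∀ x y z w : (H ⊗[k] H) ⊗[k] H,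
      lTensor A (mulLR k H ∘ₗ lTensor (H ⊗[k] H) cc)
        (aso (rTensor (H ⊗[k] H)
          (smashΛ actL actR mulA ∘ₗ TensorProduct.mk k _ (A ⊗[k] A) (z ⊗ₜ w))
          (tt (rTensor (A ⊗[k] H) (smashT actR Δ) (osa (lTensor A (lc ∘ₗ lTensor A cc)
            (u ⊗ₜ smashΛ actL actR mulA ((x ⊗ₜ y) ⊗ₜ (u' ⊗ₜ u''))))))))) =
      quadAct actL actR (mulA ∘ₗ lTensor A mulA ∘ₗ aso) u u' u''
        ((comulSnd Δ z * oneTmul k H x) ⊗ₜ (comulFst Δ y * comulThd Δ w)) from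
    this Φinv Φinv Φinv Φinv
  intro x y z w
  induction x using tmul₃_induction with
  | add x y hx hy => simp only [map_add, add_tmul, tmul_add, mul_add₄, hx, hy]
  | tmul x₁ x₂ x₃ =>
  induction y using tmul₃_induction with
  | add x y hx hy => simp only [map_add, add_tmul, tmul_add, add_mul₄, hx, hy]
  | tmul y₁ y₂ y₃ =>
  simp only [smashΛ_tmul, osa_tmul, cc_tmul, lc_tmul, lTensor_tmul, rTensor_tmul, comp_apply,
    smashT_tmul, comulFst_tmul, oneTmul_tmul]
  induction Δ y₁ using tmul_induction with
  | add x y hx hy => simp only [map_add, add_tmul, tmul_add, add_mul₄, hx, hy]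
  | tmul a b =>
  induction z using tmul₃_induction with
  | add x y hx hy =>
    simp only [map_add, add_tmul, add_mul₄, comp_add, rTensor_add, LinearMap.add_apply, hx, hy]
  | tmul z₁ z₂ z₃ =>
  induction w using tmul₃_induction with
  | add x y hx hy =>
    simp only [map_add, tmul_add, mul_add₄, comp_add, rTensor_add, LinearMap.add_apply, hx, hy]
  | tmul w₁ w₂ w₃ =>
  simp only [smashΛ_tmul, aso_tmul, osa_tmul, cc_tmul, tt_tmul, lTensor_tmul, rTensor_tmul,
    comp_apply, mk_apply, mulLR_tmul, comulThd_tmul, comulSnd_tmul, hba.actL_mulA,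
    AlgHom.toLinearMap_apply]
  induction Δ z₂ using tmul_induction with
  | add x y hx hy => simp only [map_add, add_tmul, tmul_add, add_mul₄, hx, hy]
  | tmul c d =>
  simp only [tt_tmul, map_tmul, hba.actR_mulA, AlgHom.toLinearMap_apply]
  induction Δ w₃ using tmul_induction with
  | add x y hx hy => simp only [map_add, add_tmul, tmul_add, mul_add₄, hx, hy]
  | tmul p q => simp [← hba.actL_actR, hba.actL_actL, hba.actR_actR]

theorem lrax9 (hqb : IsQuasiBialgebra Δ ε Φ Φinv)
    (hba : IsBimoduleAlgebra actL actR mulA Δ ε Φ Φinv oneA) :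
    LRax9 k (smashJ actL Δ) (smashT actR Δ) (smashη actL actR mulA Φinv) := by
  intro u u' u''
  rw [hba.lrax9_left, hba.lrax9_right, hba.quadAct_assoc, hqb.pentagon_inv, ← mul_assoc₄,
    ← mul_assoc₄, hqb.map_mul_inv (tmulOne k H), one_mul₄]

theorem lrax10_left (hba : IsBimoduleAlgebra actL actR mulA Δ ε Φ Φinv oneA)
    (u u' : A) (h : H) :
    lTensor A (lTensor A (mH k H ∘ₗ cc)) (aso (tt (rTensor (A ⊗[k] H) (smashT actR Δ)
      (osa (lTensor A cc (aso (rTensor H (smashγ actL actR Φinv)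
        (osa (u ⊗ₜ smashJ actL Δ (h ⊗ₜ u')))))))))) =
    smashΓ actL actR ((Φinv * comulRight Δ (Δ h)) ⊗ₜ (u ⊗ₜ u')) := by
  rw [smashJ_tmul]
  induction Δ h using tmul_induction with
  | add x y hx hy => simp only [map_add, add_tmul, tmul_add, mul_add, hx, hy]
  | tmul a b =>
    simp only [aso_tmul, osa_tmul, cc_tmul, lTensor_tmul, rTensor_tmul, smashγ_tmul,
      comulRight_tmul]
    generalize Φinv = z
    induction z using tmul₃_induction with
    | add x y hx hy => simp only [map_add, add_tmul, add_mul, hx, hy]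
    | tmul z₁ z₂ z₃ =>
      simp only [smashΓ_tmul, aso_tmul, osa_tmul, cc_tmul, lTensor_tmul, rTensor_tmul,
        smashT_tmul]
      induction Δ b using tmul_induction with
      | add x y hx hy => simp only [map_add, add_tmul, tmul_add, mul_add, hx, hy]
      | tmul c d => simp [hba.actR_actR, hba.actL_actL]

theorem lrax10_right (hba : IsBimoduleAlgebra actL actR mulA Δ ε Φ Φinv oneA)
    (u u' : A) (h : H) :
    lTensor A (qJ k (smashJ actL Δ)) (aso (rTensor H (smashγ actL actR Φinv)
      (osa (lTensor A cc (aso (smashT actR Δ (u ⊗ₜ h) ⊗ₜ u')))))) =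
    smashΓ actL actR ((comulLeft Δ (Δ h) * Φinv) ⊗ₜ (u ⊗ₜ u')) := by
  rw [smashT_tmul]
  induction Δ h using tmul_induction with
  | add x y hx hy => simp only [map_add, add_tmul, tmul_add, add_mul, hx, hy]
  | tmul a b =>
    simp only [aso_tmul, osa_tmul, cc_tmul, lTensor_tmul, rTensor_tmul, smashγ_tmul,
      comulLeft_tmul]
    generalize Φinv = z
    induction z using tmul₃_induction with
    | add x y hx hy => simp only [map_add, add_tmul, mul_add, hx, hy]
    | tmul z₁ z₂ z₃ =>
      simp only [smashΓ_tmul, aso_tmul, osa_tmul, cc_tmul, lc_tmul, lTensor_tmul, rTensor_tmul,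
        qJ, comp_apply, smashJ_tmul]
      induction Δ a using tmul_induction with
      | add x y hx hy => simp only [map_add, add_tmul, tmul_add, add_mul, hx, hy]
      | tmul c d => simp [hba.actR_actR, hba.actL_actL]

theorem lrax10 (hqb : IsQuasiBialgebra Δ ε Φ Φinv)
    (hba : IsBimoduleAlgebra actL actR mulA Δ ε Φ Φinv oneA) :
    LRax10 k (smashJ actL Δ) (smashT actR Δ) (smashγ actL actR Φinv) := by
  intro u u' h
  rw [hba.lrax10_left, hba.lrax10_right, hqb.comulRight_comul_mul_inv]

theorem lrax11_left (hba : IsBimoduleAlgebra actL actR mulA Δ ε Φ Φinv oneA) (u u' u'' : A) :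
    lTensor A (psi11 k) (aso (tt (rTensor ((A ⊗[k] H) ⊗[k] H) (smashT actR Δ)
      (tt (rTensor (H ⊗[k] H) (smashγ actL actR Φinv)
        (osa (u ⊗ₜ smashη actL actR mulA Φinv (u' ⊗ₜ u'')))))))) =
    γηAct actL actR mulA u u' u'' ((comulFst Δ Φinv * comulThd Δ Φinv) ⊗ₜ Φinv) := by
  suffices ∀ x y z : (H ⊗[k] H) ⊗[k] H,
      lTensor A (psi11 k) (aso (tt (rTensor ((A ⊗[k] H) ⊗[k] H) (smashT actR Δ)
        (tt (rTensor (H ⊗[k] H) (smashΓ actL actR ∘ₗ TensorProduct.mk k _ (A ⊗[k] A) z)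
          (osa (u ⊗ₜ smashΛ actL actR mulA ((x ⊗ₜ y) ⊗ₜ (u' ⊗ₜ u''))))))))) =
      γηAct actL actR mulA u u' u'' ((comulFst Δ z * comulThd Δ x) ⊗ₜ y) from
    this Φinv Φinv Φinv
  intro x y z
  induction x using tmul₃_induction with
  | add x y hx hy => simp only [map_add, add_tmul, tmul_add, mul_add₄, hx, hy]
  | tmul x₁ x₂ x₃ =>
  induction y using tmul₃_induction with
  | add x y hx hy => simp only [map_add, add_tmul, tmul_add, hx, hy]
  | tmul y₁ y₂ y₃ =>
  induction z using tmul₃_induction with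
  | add x y hx hy =>
    simp only [map_add, add_tmul, add_mul₄, comp_add, rTensor_add, LinearMap.add_apply, hx, hy]
  | tmul z₁ z₂ z₃ =>
  simp only [smashΛ_tmul, smashΓ_tmul, osa_tmul, tt_tmul, rTensor_tmul,
    comp_apply, mk_apply, smashT_tmul, comulThd_tmul, comulFst_tmul]
  induction Δ x₃ using tmul_induction with
  | add x y hx hy => simp only [map_add, add_tmul, tmul_add, mul_add₄, hx, hy]
  | tmul a b =>
  simp only [aso_tmul, osa_tmul, cc_tmul, tt_tmul, lTensor_tmul, rTensor_tmul, hba.actL_mulA,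
    AlgHom.toLinearMap_apply, psi11_tmul]
  induction Δ z₁ using tmul_induction with
  | add x y hx hy => simp only [map_add, add_tmul, tmul_add, add_mul₄, hx, hy]
  | tmul c d => simp [← hba.actL_actR, hba.actL_actL, hba.actR_actR]

theorem lrax11_right (hba : IsBimoduleAlgebra actL actR mulA Δ ε Φ Φinv oneA) (u u' u'' : A) :
    lTensor A (chainX k (smashJ actL Δ) (smashη actL actR mulA Φinv))
      (aso (rTensor (A ⊗[k] H) (smashγ actL actR Φinv) (osa (lTensor A cc
        (aso (smashγ actL actR Φinv (u ⊗ₜ u') ⊗ₜ u'')))))) =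
    γηAct actL actR mulA u u' u''
      ((tmulOne k H Φinv * comulSnd Δ Φinv * oneTmul k H Φinv) ⊗ₜ Φinv) := by
  suffices ∀ x y z w : (H ⊗[k] H) ⊗[k] H,
      lTensor A (chainX k (smashJ actL Δ)
          (smashΛ actL actR mulA ∘ₗ TensorProduct.mk k _ (A ⊗[k] A) (x ⊗ₜ y)))
        (aso (rTensor (A ⊗[k] H) (smashΓ actL actR ∘ₗ TensorProduct.mk k _ (A ⊗[k] A) w)
          (osa (lTensor A cc (aso (smashΓ actL actR (z ⊗ₜ (u ⊗ₜ u')) ⊗ₜ u'')))))) =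
      γηAct actL actR mulA u u' u''
        ((tmulOne k H x * comulSnd Δ z * oneTmul k H w) ⊗ₜ y) from
    this Φinv Φinv Φinv Φinv
  intro x y z w
  induction z using tmul₃_induction with
  | add x y hx hy => simp only [map_add, add_tmul, add_mul₄, mul_add₄, hx, hy]
  | tmul z₁ z₂ z₃ =>
  induction w using tmul₃_induction with
  | add x y hx hy =>
    simp only [map_add, add_tmul, mul_add₄, comp_add, rTensor_add, LinearMap.add_apply, hx, hy]
  | tmul w₁ w₂ w₃ =>
  simp only [smashΓ_tmul, aso_tmul, osa_tmul, cc_tmul, lTensor_tmul, rTensor_tmul,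
    comp_apply, mk_apply, chainX_tmul, smashJ_tmul, comulSnd_tmul, oneTmul_tmul, tmulOne_apply]
  induction Δ z₂ using tmul_induction with
  | add x y hx hy => simp only [map_add, add_tmul, tmul_add, add_mul₄, mul_add₄, hx, hy]
  | tmul a b =>
  simp only [aso_tmul, osa_tmul, cc_tmul, tt_tmul, lTensor_tmul, rTensor_tmul,
    comp_apply, mk_apply]
  induction x using tmul₃_induction with
  | add x y hx hy => simp only [map_add, add_tmul, tmul_add, add_mul₄, hx, hy]
  | tmul x₁ x₂ x₃ =>
  induction y using tmul₃_induction with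
  | add x y hx hy => simp only [map_add, add_tmul, tmul_add, hx, hy]
  | tmul y₁ y₂ y₃ => simp [hba.actL_actL, hba.actR_actR, mul_assoc]

theorem lrax11 (hqb : IsQuasiBialgebra Δ ε Φ Φinv)
    (hba : IsBimoduleAlgebra actL actR mulA Δ ε Φ Φinv oneA) :
    LRax11 k (smashJ actL Δ) (smashT actR Δ) (smashγ actL actR Φinv)
      (smashη actL actR mulA Φinv) := by
  intro u u' u''
  rw [hba.lrax11_left, hba.lrax11_right, hqb.pentagon_inv]

theorem lrax12_left (hba : IsBimoduleAlgebra actL actR mulA Δ ε Φ Φinv oneA) (u u' u'' : A) :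
    lTensor A (chain12 k (smashJ actL Δ))
      (aso (rTensor (H ⊗[k] H) (smashγ actL actR Φinv) (osa (lTensor A cc
        (aso (smashη actL actR mulA Φinv (u ⊗ₜ u') ⊗ₜ u'')))))) =
    ηγAct actL actR mulA u u' u'' (Φinv ⊗ₜ (comulFst Δ Φinv * comulThd Δ Φinv)) := by
  suffices ∀ x y z : (H ⊗[k] H) ⊗[k] H,
      lTensor A (chain12 k (smashJ actL Δ))
        (aso (rTensor (H ⊗[k] H) (smashΓ actL actR ∘ₗ TensorProduct.mk k _ (A ⊗[k] A) z)
          (osa (lTensor A cc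
            (aso (smashΛ actL actR mulA ((x ⊗ₜ y) ⊗ₜ (u ⊗ₜ u')) ⊗ₜ u'')))))) =
      ηγAct actL actR mulA u u' u'' (x ⊗ₜ (comulFst Δ y * comulThd Δ z)) from
    this Φinv Φinv Φinv
  intro x y z
  induction x using tmul₃_induction with
  | add x y hx hy => simp only [map_add, add_tmul, hx, hy]
  | tmul x₁ x₂ x₃ =>
  induction y using tmul₃_induction with
  | add x y hx hy => simp only [map_add, add_tmul, tmul_add, add_mul₄, hx, hy]
  | tmul y₁ y₂ y₃ =>
  induction z using tmul₃_induction with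
  | add x y hx hy =>
    simp only [map_add, tmul_add, mul_add₄, comp_add, rTensor_add, LinearMap.add_apply, hx, hy]
  | tmul z₁ z₂ z₃ =>
  simp only [smashΛ_tmul, smashΓ_tmul, aso_tmul, osa_tmul, cc_tmul, lTensor_tmul, rTensor_tmul,
    comp_apply, mk_apply, chain12_tmul, smashJ_tmul, comulThd_tmul, comulFst_tmul]
  induction Δ y₁ using tmul_induction with
  | add x y hx hy => simp only [map_add, add_tmul, tmul_add, add_mul₄, hx, hy]
  | tmul a b =>
  simp only [aso_tmul, osa_tmul, cc_tmul, tt_tmul, lTensor_tmul, rTensor_tmul, hba.actR_mulA,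
    AlgHom.toLinearMap_apply, w12_tmul]
  induction Δ z₃ using tmul_induction with
  | add x y hx hy => simp only [map_add, add_tmul, tmul_add, mul_add₄, hx, hy]
  | tmul c d => simp [hba.actL_actL, hba.actR_actR]

theorem lrax12_right (hba : IsBimoduleAlgebra actL actR mulA Δ ε Φ Φinv oneA) (u u' u'' : A) :
    lTensor A (big12 k)
      (aso (rTensor (H ⊗[k] (A ⊗[k] H)) (smashη actL actR mulA Φinv)
        (tt (lTensor (A ⊗[k] H) cc (rTensor ((A ⊗[k] H) ⊗[k] A) (smashT actR Δ)
          (tt (lTensor (A ⊗[k] (A ⊗[k] H)) cc (rTensor (A ⊗[k] H) (smashγ actL actR Φinv)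
            (osa (lTensor A lc (u ⊗ₜ smashγ actL actR Φinv (u' ⊗ₜ u'')))))))))))) =
    ηγAct actL actR mulA u u' u''
      (Φinv ⊗ₜ (tmulOne k H Φinv * comulSnd Δ Φinv * oneTmul k H Φinv)) := by
  suffices ∀ x y z w : (H ⊗[k] H) ⊗[k] H,
      lTensor A (big12 k)
        (aso (rTensor (H ⊗[k] (A ⊗[k] H))
          (smashΛ actL actR mulA ∘ₗ TensorProduct.mk k _ (A ⊗[k] A) (x ⊗ₜ y))
          (tt (lTensor (A ⊗[k] H) cc (rTensor ((A ⊗[k] H) ⊗[k] A) (smashT actR Δ)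
            (tt (lTensor (A ⊗[k] (A ⊗[k] H)) cc (rTensor (A ⊗[k] H)
              (smashΓ actL actR ∘ₗ TensorProduct.mk k _ (A ⊗[k] A) w)
              (osa (lTensor A lc (u ⊗ₜ smashΓ actL actR (z ⊗ₜ (u' ⊗ₜ u''))))))))))))) =
      ηγAct actL actR mulA u u' u''
        (x ⊗ₜ (tmulOne k H w * comulSnd Δ z * oneTmul k H y)) from
    this Φinv Φinv Φinv Φinv
  intro x y z w
  induction z using tmul₃_induction with
  | add x y hx hy => simp only [map_add, add_tmul, tmul_add, add_mul₄, mul_add₄, hx, hy]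
  | tmul z₁ z₂ z₃ =>
  induction w using tmul₃_induction with
  | add x y hx hy =>
    simp only [map_add, tmul_add, add_mul₄, comp_add, rTensor_add, LinearMap.add_apply, hx, hy]
  | tmul w₁ w₂ w₃ =>
  simp only [smashΓ_tmul, osa_tmul, cc_tmul, lc_tmul, tt_tmul, lTensor_tmul, rTensor_tmul,
    comp_apply, mk_apply, smashT_tmul, comulSnd_tmul, tmulOne_apply]
  induction Δ z₂ using tmul_induction with
  | add x y hx hy => simp only [map_add, add_tmul, tmul_add, add_mul₄, mul_add₄, hx, hy]
  | tmul a b =>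
  simp only [osa_tmul, cc_tmul, tt_tmul, rTensor_tmul, comp_apply, mk_apply]
  induction x using tmul₃_induction with
  | add x y hx hy => simp only [map_add, add_tmul, hx, hy]
  | tmul x₁ x₂ x₃ =>
  induction y using tmul₃_induction with
  | add x y hx hy => simp only [map_add, add_tmul, tmul_add, mul_add₄, hx, hy]
  | tmul y₁ y₂ y₃ => simp [hba.actL_actR, hba.actL_actL, hba.actR_actR, mul_assoc]

theorem lrax12 (hqb : IsQuasiBialgebra Δ ε Φ Φinv)
    (hba : IsBimoduleAlgebra actL actR mulA Δ ε Φ Φinv oneA) :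
    LRax12 k (smashJ actL Δ) (smashT actR Δ) (smashγ actL actR Φinv)
      (smashη actL actR mulA Φinv) := by
  intro u u' u''
  rw [hba.lrax12_left, hba.lrax12_right, hqb.pentagon_inv]

theorem lrax13_left (hba : IsBimoduleAlgebra actL actR mulA Δ ε Φ Φinv oneA) (u u' u'' : A)
    (h h' : H) :
    rTensor (A ⊗[k] H) (xi k (smashJ actL Δ))
      (osa (h' ⊗ₜ (lTensor (A ⊗[k] (A ⊗[k] H)) (w13 k)
        (aso (rTensor (A ⊗[k] H) (rTensor H (smashγ actL actR Φinv))
          (rTensor (A ⊗[k] H) osa (osa (u ⊗ₜ (rTensor (A ⊗[k] H) (smashT actR Δ)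
            (osa (lTensor A cc
              (aso (smashγ actL actR Φinv (u' ⊗ₜ u'') ⊗ₜ h))))))))))))) =
    γγAct actL actR u u' u'' (((Δ h' ⊗ₜ 1) * Φinv) ⊗ₜ (Φinv * osa (1 ⊗ₜ Δ h))) := by
  suffices ∀ z w : (H ⊗[k] H) ⊗[k] H,
      rTensor (A ⊗[k] H) (xi k (smashJ actL Δ))
        (osa (h' ⊗ₜ (lTensor (A ⊗[k] (A ⊗[k] H)) (w13 k)
          (aso (rTensor (A ⊗[k] H)
            (rTensor H (smashΓ actL actR ∘ₗ TensorProduct.mk k _ (A ⊗[k] A) w))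
            (rTensor (A ⊗[k] H) osa (osa (u ⊗ₜ (rTensor (A ⊗[k] H) (smashT actR Δ)
              (osa (lTensor A cc
                (aso (smashΓ actL actR (z ⊗ₜ (u' ⊗ₜ u'')) ⊗ₜ h))))))))))))) =
      γγAct actL actR u u' u'' (((Δ h' ⊗ₜ 1) * w) ⊗ₜ (z * osa (1 ⊗ₜ Δ h))) from
    this Φinv Φinv
  intro z w
  induction z using tmul₃_induction with
  | add x y hx hy => simp only [map_add, add_tmul, tmul_add, add_mul, hx, hy]
  | tmul z₁ z₂ z₃ =>
  induction w using tmul₃_induction with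
  | add x y hx hy =>
    simp only [map_add, add_tmul, tmul_add, mul_add, comp_add, rTensor_add,
      LinearMap.add_apply, hx, hy]
  | tmul w₁ w₂ w₃ =>
  simp only [smashΓ_tmul, aso_tmul, osa_tmul, cc_tmul, lTensor_tmul, rTensor_tmul, smashT_tmul]
  induction Δ h using tmul_induction with
  | add x y hx hy => simp only [map_add, add_tmul, tmul_add, mul_add, hx, hy]
  | tmul a b =>
  simp only [smashΓ_tmul, aso_tmul, osa_tmul, cc_tmul, lTensor_tmul, rTensor_tmul, comp_apply,
    mk_apply, xi_tmul, smashJ_tmul]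
  induction Δ h' using tmul_induction with
  | add x y hx hy => simp only [map_add, add_tmul, tmul_add, add_mul, hx, hy]
  | tmul c d => simp [hba.actL_actR, hba.actL_actL, hba.actR_actR]

theorem lrax13_right (hba : IsBimoduleAlgebra actL actR mulA Δ ε Φ Φinv oneA) (u u' u'' : A)
    (h h' : H) :
    rhs13 k (smashJ actL Δ) (smashT actR Δ) (smashγ actL actR Φinv)
      (((h' ⊗ₜ (u ⊗ₜ u')) ⊗ₜ u'') ⊗ₜ h) =
    γγAct actL actR u u' u'' (((Δ h' ⊗ₜ 1) * Φinv) ⊗ₜ (Φinv * osa (1 ⊗ₜ Δ h))) := by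
  simp only [rhs13, comp_apply, rTensor_tmul, lTensor_tmul, smashγ_tmul]
  suffices ∀ z w : (H ⊗[k] H) ⊗[k] H,
      osa (lTensor A (chainR k (smashT actR Δ)) (aso (lTensor A
        (rho k (smashΓ actL actR ∘ₗ TensorProduct.mk k _ (A ⊗[k] A) z))
        (aso (xi k (smashJ actL Δ) (h' ⊗ₜ smashΓ actL actR (w ⊗ₜ (u ⊗ₜ u'))) ⊗ₜ u'')) ⊗ₜ h))) =
      γγAct actL actR u u' u'' (((Δ h' ⊗ₜ 1) * w) ⊗ₜ (z * osa (1 ⊗ₜ Δ h))) from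
    this Φinv Φinv
  intro z w
  induction w using tmul₃_induction with
  | add x y hx hy => simp only [map_add, add_tmul, tmul_add, mul_add, hx, hy]
  | tmul w₁ w₂ w₃ =>
  simp only [smashΓ_tmul, xi_tmul, smashJ_tmul]
  induction Δ h' using tmul_induction with
  | add x y hx hy => simp only [map_add, add_tmul, tmul_add, add_mul, hx, hy]
  | tmul c d =>
  simp only [aso_tmul, osa_tmul, cc_tmul, lTensor_tmul, rTensor_tmul, rho_tmul, comp_apply,
    mk_apply]
  induction z using tmul₃_induction with
  | add x y hx hy => simp only [map_add, add_tmul, tmul_add, add_mul, hx, hy]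
  | tmul z₁ z₂ z₃ =>
  simp only [smashΓ_tmul, aso_tmul, lTensor_tmul, chainR_tmul, smashT_tmul]
  induction Δ h using tmul_induction with
  | add x y hx hy => simp only [map_add, add_tmul, tmul_add, mul_add, hx, hy]
  | tmul a b => simp [hba.actL_actR, hba.actL_actL, hba.actR_actR]

theorem lrax13 (hba : IsBimoduleAlgebra actL actR mulA Δ ε Φ Φinv oneA) :
    LRax13 k (smashJ actL Δ) (smashT actR Δ) (smashγ actL actR Φinv) := by
  intro u u' u'' h h'
  rw [hba.lrax13_left, hba.lrax13_right]

end IsBimoduleAlgebra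

end Axioms

/-- Let `H` be a quasi-bialgebra and `A` an `H`-bimodule algebra. Then the
maps `J(h⊗φ) = h₁·φ ⊗ h₂`, `T(φ⊗h) = φ·h₂ ⊗ h₁`, `γ(φ⊗φ') = φ·z³ ⊗ z¹·φ' ⊗ z²` and
`η(φ⊗φ') = (x¹·φ·y²)(x²·φ'·y³) ⊗ x³ ⊗ y¹` (with `x`, `y`, `z` copies of `Φ⁻¹`) satisfy
the L-R-crossed product axioms (1)-(13), with `U = A` and `1_U = 1_A`. -/
theorem bimodule_algebra_gives_lr_crossed_product
    {k : Type*} [Field k] {H : Type*} [Ring H] [Algebra k H]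
    {A : Type*} [AddCommGroup A] [Module k A]
    (Δ : H →ₐ[k] H ⊗[k] H) (ε : H →ₐ[k] k) (Φ Φinv : (H ⊗[k] H) ⊗[k] H)
    (actL : H ⊗[k] A →ₗ[k] A) (actR : A ⊗[k] H →ₗ[k] A)
    (mulA : A ⊗[k] A →ₗ[k] A) (oneA : A)
    (hqb : IsQuasiBialgebra Δ ε Φ Φinv)
    (hba : IsBimoduleAlgebra actL actR mulA Δ ε Φ Φinv oneA) :
    LRax1 k (smashJ actL Δ) oneA ∧
    LRax2 k (smashT actR Δ) oneA ∧
    LRax3 k (smashγ actL actR Φinv) oneA ∧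
    LRax4 k (smashη actL actR mulA Φinv) oneA ∧
    LRax5 k (smashJ actL Δ) ∧
    LRax6 k (smashT actR Δ) ∧
    LRax7 k (smashJ actL Δ) (smashη actL actR mulA Φinv) ∧
    LRax8 k (smashT actR Δ) (smashη actL actR mulA Φinv) ∧
    LRax9 k (smashJ actL Δ) (smashT actR Δ) (smashη actL actR mulA Φinv) ∧
    LRax10 k (smashJ actL Δ) (smashT actR Δ) (smashγ actL actR Φinv) ∧
    LRax11 k (smashJ actL Δ) (smashT actR Δ) (smashγ actL actR Φinv)
      (smashη actL actR mulA Φinv) ∧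
    LRax12 k (smashJ actL Δ) (smashT actR Δ) (smashγ actL actR Φinv)
      (smashη actL actR mulA Φinv) ∧
    LRax13 k (smashJ actL Δ) (smashT actR Δ) (smashγ actL actR Φinv) := by
  exact ⟨hba.lrax1 hqb, hba.lrax2 hqb, hba.lrax3 hqb, hba.lrax4 hqb, hba.lrax5, hba.lrax6,
    hba.lrax7 hqb, hba.lrax8 hqb, hba.lrax9 hqb, hba.lrax10 hqb, hba.lrax11 hqb,
    hba.lrax12 hqb, hba.lrax13⟩
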